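/- Let d ≥ 2, let 0 < α ≤ 1, let Ω ⊆ ℝ^d be open, bounded and nonempty, let g ∈ L^∞_α, and assume |Ω|^{2/d} λ₁^g(Ω) < 2^{2/d} |B|^{2/d} λ₁(B), where B is the open unit ball of ℝ^d. Then there exist disjoint open balls B₊, B₋ ⊂ ℝ^d with |B₊| ≥ |B₋| > 0 and |B₊ ∪ B₋| ≤ |Ω| such that |Ω|^{2/d} λ₁^g(Ω) ≥ |B₊ ∪ B₋|^{2/d} λ₁^{χ_α}(B₊ ∪ B₋), where χ_α is the bang-bang function associated with B₋ and α. -/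

import Mathlib

open MeasureTheory Metric Set Filter

open scoped Classical ENNReal

noncomputable section

/-- The Rayleigh quotient of `u : ℝ^d → ℝ`. -/
def rayleigh (d : ℕ) (u : EuclideanSpace ℝ (Fin d) → ℝ) : ℝ :=
  (∫ x, ‖gradient u x‖ ^ 2) / (∫ x, (u x) ^ 2)

/-- A trial function for the Dirichlet eigenvalue on `Ω`: Lipschitz, vanishing outside `Ω`,
and not almost everywhere zero. -/
def IsDirTrial (d : ℕ) (Ω : Set (EuclideanSpace ℝ (Fin d)))
    (u : EuclideanSpace ℝ (Fin d) → ℝ) : Prop :=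
  (∃ K, LipschitzWith K u) ∧ (∀ x ∉ Ω, u x = 0) ∧ ¬ (u =ᵐ[volume] fun _ => (0 : ℝ))

/-- The first Dirichlet eigenvalue of `Ω`. -/
def dirichletEV (d : ℕ) (Ω : Set (EuclideanSpace ℝ (Fin d))) : ℝ :=
  sInf { r | ∃ u, IsDirTrial d Ω u ∧ rayleigh d u = r }

/-- The first twisted eigenvalue of `Ω` with orthogonality constraint `g`. -/
def twistedEV (d : ℕ) (Ω : Set (EuclideanSpace ℝ (Fin d)))
    (g : EuclideanSpace ℝ (Fin d) → ℝ) : ℝ :=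
  sInf { r | ∃ u, IsDirTrial d Ω u ∧ (∫ x, u x * g x) = 0 ∧ rayleigh d u = r }

/-- `u` is a minimizer for the first twisted eigenvalue `λ₁^g(Ω)`. -/
def IsTwistedMin (d : ℕ) (Ω : Set (EuclideanSpace ℝ (Fin d)))
    (g u : EuclideanSpace ℝ (Fin d) → ℝ) : Prop :=
  IsDirTrial d Ω u ∧ (∫ x, u x * g x) = 0 ∧ rayleigh d u = twistedEV d Ω g

/-- The bang-bang function equal to `1` on `Bm` and `α` elsewhere. -/
def chiBang (d : ℕ) (α : ℝ) (Bm : Set (EuclideanSpace ℝ (Fin d))) :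
    EuclideanSpace ℝ (Fin d) → ℝ :=
  fun x => if x ∈ Bm then 1 else α

/-! ### Polarization -/

/-- `σ` is an affine hyperplane reflection, with `h` the signed distance to the hyperplane. -/
structure IsHyperplaneReflection {d : ℕ} (σ : EuclideanSpace ℝ (Fin d) → EuclideanSpace ℝ (Fin d))
    (h : EuclideanSpace ℝ (Fin d) → ℝ) : Prop where
  invol : ∀ x, σ (σ x) = x
  isom : ∀ x y, dist (σ x) (σ y) = dist x y
  mp : MeasurePreserving σ volume volume
  neg : ∀ x, h (σ x) = -h x
  dist_sq : ∀ x y, dist x (σ y) ^ 2 = dist x y ^ 2 + 4 * h x * h y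
  meas : Measurable h

/-- The two-point rearrangement of `v` with respect to the reflection `σ` with side function `h`. -/
def polarize {d : ℕ} (σ : EuclideanSpace ℝ (Fin d) → EuclideanSpace ℝ (Fin d))
    (h : EuclideanSpace ℝ (Fin d) → ℝ) (v : EuclideanSpace ℝ (Fin d) → ℝ) :
    EuclideanSpace ℝ (Fin d) → ℝ :=
  fun x => if 0 ≤ h x then max (v x) (v (σ x)) else min (v x) (v (σ x))

/-- The squared difference energy of `v` at scale `δ`. -/
def diffEnergy {d : ℕ} (δ : ℝ) (v : EuclideanSpace ℝ (Fin d) → ℝ) : ℝ≥0∞ :=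
  ∫⁻ x, ∫⁻ y, ENNReal.ofReal ((v x - v y) ^ 2 * if dist x y < δ then 1 else 0)

lemma exists_hyperplaneReflection {d : ℕ} {a b : EuclideanSpace ℝ (Fin d)} (hab : ‖a‖ < ‖b‖) :
    ∃ σ h, IsHyperplaneReflection σ h ∧ σ a = b ∧ 0 < h a ∧
      ∃ c > 0, ∀ x, ‖σ x‖ ^ 2 = ‖x‖ ^ 2 + c * h x := by
  have hne : a - b ≠ 0 := by
    intro h
    rw [sub_eq_zero.mp h] at hab
    exact lt_irrefl _ hab
  set ℓ : ℝ := ‖a - b‖ with hℓ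
  have hℓ0 : 0 < ℓ := norm_pos_iff.mpr hne
  set e : EuclideanSpace ℝ (Fin d) := ℓ⁻¹ • (b - a) with he
  have hee : inner ℝ e e = 1 := by
    rw [he, inner_smul_left, inner_smul_right, real_inner_self_eq_norm_sq, norm_sub_rev, ← hℓ]
    simp
    field_simp
  set c : ℝ := (‖b‖ ^ 2 - ‖a‖ ^ 2) / (2 * ℓ) with hc
  have hc0 : 0 < c := by
    apply div_pos _ (by positivity)
    nlinarith [norm_nonneg a, norm_nonneg b]
  have hbe : b - a = ℓ • e := by
    rw [he, smul_smul, mul_inv_cancel₀ hℓ0.ne', one_smul]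
  have hin : ∀ x : EuclideanSpace ℝ (Fin d), ∀ t : ℝ,
      ‖x + t • e‖ ^ 2 = ‖x‖ ^ 2 + 2 * t * inner ℝ x e + t ^ 2 := by
    intro x t
    rw [norm_add_sq_real, inner_smul_right, norm_smul, mul_pow,
      ← real_inner_self_eq_norm_sq e, hee]
    simp
    ring
  have hae : inner ℝ a e = c - ℓ / 2 := by
    have h1 := hin a ℓ
    rw [← hbe, add_sub_cancel] at h1
    rw [hc]
    field_simp
    linarith
  let h : EuclideanSpace ℝ (Fin d) → ℝ := fun x => c - inner ℝ x e
  let σ : EuclideanSpace ℝ (Fin d) → EuclideanSpace ℝ (Fin d) := fun x => x + (2 * h x) • e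
  have hneg : ∀ x, h (σ x) = -h x := by
    intro x
    simp only [h, σ, inner_add_left, inner_smul_left, hee]
    simp
    ring
  have hinvol : ∀ x, σ (σ x) = x := by
    intro x
    change σ x + (2 * h (σ x)) • e = x
    rw [hneg]
    simp only [σ]
    module
  have hdist : ∀ x y, dist x (σ y) ^ 2 = dist x y ^ 2 + 4 * h x * h y := by
    intro x y
    have : x - σ y = (x - y) + (-(2 * h y)) • e := by simp only [σ]; module
    rw [dist_eq_norm, dist_eq_norm, this, hin, inner_sub_left]
    simp only [h]
    ring
  have hisom : ∀ x y, dist (σ x) (σ y) = dist x y := by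
    intro x y
    have h1 : dist (σ x) (σ y) ^ 2 = dist x y ^ 2 := by
      rw [hdist, hneg, dist_comm, hdist, dist_comm]
      ring
    exact (sq_eq_sq₀ dist_nonneg dist_nonneg).mp h1
  have hmp : MeasurePreserving σ volume volume := by
    have h1 := (((ℝ ∙ e)ᗮ.reflection).measurePreserving)
    have h2 := measurePreserving_add_right (volume : Measure (EuclideanSpace ℝ (Fin d)))
      ((2 * c) • e)
    have hn : ‖e‖ = 1 := by
      have := real_inner_self_eq_norm_sq e
      rw [hee] at this
      nlinarith [norm_nonneg e]
    have h3 : σ = (fun x => x + (2 * c) • e) ∘ (ℝ ∙ e)ᗮ.reflection := by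
      funext x
      simp only [Function.comp, σ, h]
      rw [Submodule.reflection_orthogonal_apply, Submodule.reflection_singleton_apply, hn,
        real_inner_comm]
      simp only [RCLike.ofReal_real_eq_id, id, one_pow, div_one]
      module
    rw [h3]
    exact h2.comp h1
  refine ⟨σ, h, ⟨hinvol, hisom, hmp, hneg, hdist, ?_⟩, ?_, ?_, 4 * c, by positivity, ?_⟩
  · fun_prop
  · simp only [σ, h, hae]
    rw [show 2 * (c - (c - ℓ / 2)) = ℓ by ring, ← hbe]
    abel
  · simp only [h, hae]
    linarith
  · intro x
    have h1 := hdist 0 x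
    simp only [dist_zero_left] at h1
    rw [h1]
    simp only [h, inner_zero_left]
    ring

namespace IsHyperplaneReflection

variable {d : ℕ} {σ : EuclideanSpace ℝ (Fin d) → EuclideanSpace ℝ (Fin d)}
  {h v : EuclideanSpace ℝ (Fin d) → ℝ}

lemma eq_of_side_eq_zero (H : IsHyperplaneReflection σ h) {x : EuclideanSpace ℝ (Fin d)}
    (hx : h x = 0) : σ x = x := by
  have h1 := H.dist_sq x x
  rw [hx] at h1
  simp at h1
  exact h1.symm

lemma dist_le (H : IsHyperplaneReflection σ h) {x y : EuclideanSpace ℝ (Fin d)}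
    (hxy : 0 ≤ h x * h y) : dist x y ≤ dist x (σ y) := by
  have h1 := H.dist_sq x y
  exact le_of_sq_le_sq (by nlinarith) dist_nonneg

lemma dist_ge (H : IsHyperplaneReflection σ h) {x y : EuclideanSpace ℝ (Fin d)}
    (hxy : h x * h y ≤ 0) : dist x (σ y) ≤ dist x y := by
  have h1 := H.dist_sq x y
  exact le_of_sq_le_sq (by nlinarith) dist_nonneg

lemma dist_reflect_left (H : IsHyperplaneReflection σ h) (x y : EuclideanSpace ℝ (Fin d)) :
    dist (σ x) y = dist x (σ y) := by
  rw [← H.isom x (σ y), H.invol]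

lemma polarize_of_nonneg (H : IsHyperplaneReflection σ h) (v : EuclideanSpace ℝ (Fin d) → ℝ)
    {x : EuclideanSpace ℝ (Fin d)} (hx : 0 ≤ h x) :
    polarize σ h v x = max (v x) (v (σ x)) ∧ polarize σ h v (σ x) = min (v x) (v (σ x)) := by
  refine ⟨if_pos hx, ?_⟩
  rcases hx.lt_or_eq with hx | hx
  · rw [polarize, if_neg (by rw [H.neg]; linarith), H.invol, min_comm]
  · have := H.eq_of_side_eq_zero hx.symm
    simp [polarize, this]

lemma polarize_of_nonpos (H : IsHyperplaneReflection σ h) (v : EuclideanSpace ℝ (Fin d) → ℝ)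
    {x : EuclideanSpace ℝ (Fin d)} (hx : h x ≤ 0) :
    polarize σ h v x = min (v x) (v (σ x)) ∧ polarize σ h v (σ x) = max (v x) (v (σ x)) := by
  have h1 := H.polarize_of_nonneg v (x := σ x) (by rw [H.neg]; linarith)
  rw [H.invol] at h1
  rw [min_comm, max_comm]
  exact ⟨h1.2, h1.1⟩

lemma polarize_pair (H : IsHyperplaneReflection σ h) (v : EuclideanSpace ℝ (Fin d) → ℝ)
    (x : EuclideanSpace ℝ (Fin d)) :
    (polarize σ h v x = v x ∧ polarize σ h v (σ x) = v (σ x)) ∨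
      (polarize σ h v x = v (σ x) ∧ polarize σ h v (σ x) = v x) := by
  rcases le_total 0 (h x) with hx | hx
  · obtain ⟨h1, h2⟩ := H.polarize_of_nonneg v hx
    rw [h1, h2]
    rcases le_total (v x) (v (σ x)) with h3 | h3 <;> simp [h3]
  · obtain ⟨h1, h2⟩ := H.polarize_of_nonpos v hx
    rw [h1, h2]
    rcases le_total (v x) (v (σ x)) with h3 | h3 <;> simp [h3]

lemma lipschitzWith_polarize (H : IsHyperplaneReflection σ h) {K : NNReal}
    (hv : LipschitzWith K v) : LipschitzWith K (polarize σ h v) := by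
  refine LipschitzWith.of_le_add_mul K fun x y => ?_
  have hl : ∀ p q, v p ≤ v q + K * dist p q := hv.le_add_mul
  have e1 := H.dist_reflect_left x y
  have e2 := H.isom x y
  have a1 := hl x y
  have a2 := hl (σ x) (σ y)
  have a3 := hl x (σ y)
  have a4 := hl (σ x) y
  rw [e2] at a2
  rw [e1] at a4
  rcases le_total 0 (h x) with hx | hx <;> rcases le_total 0 (h y) with hy | hy
  · rw [(H.polarize_of_nonneg v hx).1, (H.polarize_of_nonneg v hy).1]
    apply max_le
    · exact a1.trans (by gcongr; exact le_max_left _ _)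
    · exact a2.trans (by gcongr; exact le_max_right _ _)
  · rw [(H.polarize_of_nonneg v hx).1, (H.polarize_of_nonpos v hy).1]
    have hd : (K : ℝ) * dist x (σ y) ≤ K * dist x y := by
      gcongr
      exact H.dist_ge (mul_nonpos_of_nonneg_of_nonpos hx hy)
    rw [← min_add_add_right]
    apply max_le <;> apply le_min <;> linarith
  · rw [(H.polarize_of_nonpos v hx).1, (H.polarize_of_nonneg v hy).1]
    exact (min_le_left _ _).trans (a1.trans (by gcongr; exact le_max_left _ _))
  · rw [(H.polarize_of_nonpos v hx).1, (H.polarize_of_nonpos v hy).1, ← min_add_add_right]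
    exact le_min ((min_le_left _ _).trans a1) ((min_le_right _ _).trans a2)

lemma four_point_ineq {a b c e k l : ℝ} (hk : l ≤ k) :
    (max a b - max c e) ^ 2 * k + (min a b - min c e) ^ 2 * k + (max a b - min c e) ^ 2 * l
        + (min a b - max c e) ^ 2 * l
      ≤ (a - c) ^ 2 * k + (b - e) ^ 2 * k + (a - e) ^ 2 * l + (b - c) ^ 2 * l := by
  rcases le_total a b with h1 | h1 <;> rcases le_total c e with h2 | h2 <;>
    simp only [h1, h2, max_eq_left, max_eq_right, min_eq_left, min_eq_right] <;>
    nlinarith [mul_nonneg (mul_nonneg (sub_nonneg.2 h1) (sub_nonneg.2 h2)) (sub_nonneg.2 hk)]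

lemma four_point_polarize (H : IsHyperplaneReflection σ h) (v : EuclideanSpace ℝ (Fin d) → ℝ)
    {k : ℝ → ℝ} (hk : Antitone k) (x y : EuclideanSpace ℝ (Fin d)) :
    let w := polarize σ h v
    (w x - w y) ^ 2 * k (dist x y) + (w (σ x) - w (σ y)) ^ 2 * k (dist (σ x) (σ y))
        + (w x - w (σ y)) ^ 2 * k (dist x (σ y)) + (w (σ x) - w y) ^ 2 * k (dist (σ x) y)
      ≤ (v x - v y) ^ 2 * k (dist x y) + (v (σ x) - v (σ y)) ^ 2 * k (dist (σ x) (σ y))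
        + (v x - v (σ y)) ^ 2 * k (dist x (σ y)) + (v (σ x) - v y) ^ 2 * k (dist (σ x) y) := by
  dsimp only
  rw [H.isom, H.dist_reflect_left]
  rcases le_total 0 (h x) with hx | hx <;> rcases le_total 0 (h y) with hy | hy
  · have := hk (H.dist_le (mul_nonneg hx hy))
    rw [(H.polarize_of_nonneg v hx).1, (H.polarize_of_nonneg v hx).2,
      (H.polarize_of_nonneg v hy).1, (H.polarize_of_nonneg v hy).2]
    linarith [four_point_ineq (a := v x) (b := v (σ x)) (c := v y) (e := v (σ y)) this]
  · have := hk (H.dist_ge (mul_nonpos_of_nonneg_of_nonpos hx hy))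
    rw [(H.polarize_of_nonneg v hx).1, (H.polarize_of_nonneg v hx).2,
      (H.polarize_of_nonpos v hy).1, (H.polarize_of_nonpos v hy).2]
    have := four_point_ineq (a := v x) (b := v (σ x)) (c := v (σ y)) (e := v y) this
    rw [max_comm (v (σ y)), min_comm (v (σ y))] at this
    linarith
  · have := hk (H.dist_ge (mul_nonpos_of_nonpos_of_nonneg hx hy))
    rw [(H.polarize_of_nonpos v hx).1, (H.polarize_of_nonpos v hx).2,
      (H.polarize_of_nonneg v hy).1, (H.polarize_of_nonneg v hy).2]
    have := four_point_ineq (a := v x) (b := v (σ x)) (c := v (σ y)) (e := v y) this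
    rw [max_comm (v (σ y)), min_comm (v (σ y))] at this
    linarith
  · have := hk (H.dist_le (mul_nonneg_of_nonpos_of_nonpos hx hy))
    rw [(H.polarize_of_nonpos v hx).1, (H.polarize_of_nonpos v hx).2,
      (H.polarize_of_nonpos v hy).1, (H.polarize_of_nonpos v hy).2]
    linarith [four_point_ineq (a := v x) (b := v (σ x)) (c := v y) (e := v (σ y)) this]

lemma lintegral_lintegral_fold (H : IsHyperplaneReflection σ h)
    {F : EuclideanSpace ℝ (Fin d) → EuclideanSpace ℝ (Fin d) → ℝ≥0∞}
    (hF : Measurable (Function.uncurry F)) :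
    ∫⁻ x, ∫⁻ y, (F x y + F (σ x) (σ y) + F x (σ y) + F (σ x) y) = 4 * ∫⁻ x, ∫⁻ y, F x y := by
  have hσ := H.mp.measurable
  have hFx : ∀ x, Measurable (F x) := fun x => hF.comp measurable_prodMk_left
  have hG : Measurable fun x => ∫⁻ y, F x y := hF.lintegral_prod_right'
  have i1 : ∀ x, ∫⁻ y, F x (σ y) = ∫⁻ y, F x y := fun x => H.mp.lintegral_comp (hFx x)
  have i2 : ∫⁻ x, ∫⁻ y, F (σ x) y = ∫⁻ x, ∫⁻ y, F x y := H.mp.lintegral_comp hG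
  have hin : ∀ x, ∫⁻ y, (F x y + F (σ x) (σ y) + F x (σ y) + F (σ x) y)
      = (∫⁻ y, F x y) + (∫⁻ y, F (σ x) y) + (∫⁻ y, F x y) + ∫⁻ y, F (σ x) y := by
    intro x
    have m1 := hFx x
    have m2 : Measurable fun y => F (σ x) (σ y) := (hFx (σ x)).comp hσ
    have m3 : Measurable fun y => F x (σ y) := (hFx x).comp hσ
    rw [lintegral_add_left (by fun_prop), lintegral_add_left (by fun_prop),
      lintegral_add_left m1, i1, i1]
  have m1 := hG
  have m2 : Measurable fun x => ∫⁻ y, F (σ x) y := hG.comp hσ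
  simp_rw [hin]
  rw [lintegral_add_left (by fun_prop), lintegral_add_left (by fun_prop),
    lintegral_add_left m1, i2]
  ring

lemma measurable_diffEnergy_integrand {δ : ℝ} (hv : Measurable v) :
    Measurable (Function.uncurry fun x y : EuclideanSpace ℝ (Fin d) =>
      ENNReal.ofReal ((v x - v y) ^ 2 * if dist x y < δ then 1 else 0)) := by
  apply Measurable.ennreal_ofReal
  apply Measurable.mul
  · exact ((hv.comp measurable_fst).sub (hv.comp measurable_snd)).pow_const 2
  · exact Measurable.ite (measurableSet_lt (measurable_fst.dist measurable_snd) measurable_const)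
      measurable_const measurable_const

lemma diffEnergy_polarize_le (H : IsHyperplaneReflection σ h) (hv : Measurable v)
    (hpv : Measurable (polarize σ h v)) (δ : ℝ) :
    diffEnergy δ (polarize σ h v) ≤ diffEnergy δ v := by
  have h4 : 4 * diffEnergy δ (polarize σ h v) ≤ 4 * diffEnergy δ v := by
    rw [diffEnergy, diffEnergy,
      ← H.lintegral_lintegral_fold (measurable_diffEnergy_integrand hpv),
      ← H.lintegral_lintegral_fold (measurable_diffEnergy_integrand hv)]
    refine lintegral_mono fun x => lintegral_mono fun y => ?_
    have hk : Antitone fun t : ℝ => if t < δ then (1 : ℝ) else 0 := by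
      intro s t hst
      dsimp only
      split_ifs <;> linarith
    have h0 : ∀ (u : EuclideanSpace ℝ (Fin d) → ℝ) (p q : EuclideanSpace ℝ (Fin d)),
        0 ≤ (u p - u q) ^ 2 * if dist p q < δ then (1 : ℝ) else 0 := by
      intro u p q
      split_ifs <;> positivity
    have := H.four_point_polarize v hk x y
    dsimp only at this ⊢
    rw [← ENNReal.ofReal_add (h0 _ _ _) (h0 _ _ _),
      ← ENNReal.ofReal_add (add_nonneg (h0 _ _ _) (h0 _ _ _)) (h0 _ _ _),
      ← ENNReal.ofReal_add (add_nonneg (add_nonneg (h0 _ _ _) (h0 _ _ _)) (h0 _ _ _)) (h0 _ _ _),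
      ← ENNReal.ofReal_add (h0 _ _ _) (h0 _ _ _),
      ← ENNReal.ofReal_add (add_nonneg (h0 _ _ _) (h0 _ _ _)) (h0 _ _ _),
      ← ENNReal.ofReal_add (add_nonneg (add_nonneg (h0 _ _ _) (h0 _ _ _)) (h0 _ _ _)) (h0 _ _ _)]
    exact ENNReal.ofReal_le_ofReal this
  exact (ENNReal.mul_le_mul_iff_right (by norm_num) (by norm_num)).mp h4

/-- A function and its polarization have the same distribution. -/
lemma lintegral_comp_polarize (H : IsHyperplaneReflection σ h) (hv : Measurable v)
    (hpv : Measurable (polarize σ h v)) {φ : ℝ → ℝ≥0∞} (hφ : Measurable φ) :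
    ∫⁻ x, φ (polarize σ h v x) = ∫⁻ x, φ (v x) := by
  have key : ∀ u : EuclideanSpace ℝ (Fin d) → ℝ, Measurable u →
      ∫⁻ x, (φ (u x) + φ (u (σ x))) = 2 * ∫⁻ x, φ (u x) := by
    intro u hu
    rw [lintegral_add_left (by fun_prop), H.mp.lintegral_comp (f := fun x => φ (u x)) (hφ.comp hu)]
    ring
  have h2 : 2 * ∫⁻ x, φ (polarize σ h v x) = 2 * ∫⁻ x, φ (v x) := by
    rw [← key _ hv, ← key _ hpv]
    refine lintegral_congr fun x => ?_
    rcases H.polarize_pair v x with ⟨h1, h2⟩ | ⟨h1, h2⟩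
    · rw [h1, h2]
    · rw [h1, h2, add_comm]
  exact (ENNReal.mul_right_inj (by norm_num) (by norm_num)).mp h2

end IsHyperplaneReflection

/-! ### The Dirichlet energy as a limit of difference energies -/

lemma lintegral_comp_inv_smul {d : ℕ} {f : EuclideanSpace ℝ (Fin d) → ℝ≥0∞} (hf : Measurable f)
    {c : ℝ} (hc : 0 < c) : ∫⁻ z, f (c⁻¹ • z) = ENNReal.ofReal (c ^ d) * ∫⁻ z, f z := by
  have h1 := Measure.map_addHaar_smul (volume : Measure (EuclideanSpace ℝ (Fin d)))
    (inv_ne_zero hc.ne')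
  have h2 : Measurable fun z : EuclideanSpace ℝ (Fin d) => c⁻¹ • z := by fun_prop
  rw [← lintegral_map (f := f) hf h2, h1, lintegral_smul_measure, finrank_euclideanSpace_fin,
    smul_eq_mul, ← inv_pow, inv_inv, abs_of_pos (by positivity)]

/-- The squared difference quotient of `v` at `x` with increment `c⁻¹ • z`, cut off to `‖z‖ < 1`. -/
def scaledIntegrand {d : ℕ} (c : ℝ) (v : EuclideanSpace ℝ (Fin d) → ℝ)
    (x z : EuclideanSpace ℝ (Fin d)) : ℝ≥0∞ :=
  ENNReal.ofReal ((c * (v (x + c⁻¹ • z) - v x)) ^ 2 * if ‖z‖ < 1 then 1 else 0)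

/-- Difference quotients of `v` at scale `c⁻¹`, integrated over increments in the unit ball. -/
def scaledEnergy {d : ℕ} (c : ℝ) (v : EuclideanSpace ℝ (Fin d) → ℝ) : ℝ≥0∞ :=
  ∫⁻ x, ∫⁻ z, scaledIntegrand c v x z

lemma measurable_ite_norm_lt_one {d : ℕ} :
    Measurable fun z : EuclideanSpace ℝ (Fin d) => if ‖z‖ < 1 then (1 : ℝ) else 0 :=
  Measurable.ite (measurableSet_lt measurable_norm measurable_const) measurable_const
    measurable_const

lemma scaledEnergy_eq {d : ℕ} {c : ℝ} (hc : 0 < c) {v : EuclideanSpace ℝ (Fin d) → ℝ}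
    (hv : Measurable v) :
    scaledEnergy c v = ENNReal.ofReal (c ^ (d + 2)) * diffEnergy c⁻¹ v := by
  rw [scaledEnergy, diffEnergy, ← lintegral_const_mul' _ _ ENNReal.ofReal_ne_top]
  refine lintegral_congr fun x => ?_
  let H : EuclideanSpace ℝ (Fin d) → ℝ≥0∞ := fun w =>
    ENNReal.ofReal ((c * (v (x + w) - v x)) ^ 2 * if ‖c • w‖ < 1 then 1 else 0)
  have hH : Measurable H := by
    apply Measurable.ennreal_ofReal
    apply Measurable.mul
    · fun_prop
    · exact measurable_ite_norm_lt_one.comp (measurable_const_smul c)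
  have e1 : ∀ z, ENNReal.ofReal ((c * (v (x + c⁻¹ • z) - v x)) ^ 2 * if ‖z‖ < 1 then 1 else 0)
      = H (c⁻¹ • z) := by
    intro z
    simp only [H]
    rw [smul_smul, mul_inv_cancel₀ hc.ne', one_smul]
  simp_rw [scaledIntegrand, e1]
  rw [lintegral_comp_inv_smul hH hc, ← lintegral_sub_right_eq_self H x, pow_add,
    ENNReal.ofReal_mul (by positivity), mul_assoc]
  congr 1
  rw [← lintegral_const_mul' _ _ ENNReal.ofReal_ne_top]
  refine lintegral_congr fun y => ?_
  simp only [H]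
  rw [← ENNReal.ofReal_mul (by positivity), add_sub_cancel]
  congr 1
  have : (‖c • (y - x)‖ < 1) ↔ dist x y < c⁻¹ := by
    rw [norm_smul, Real.norm_of_nonneg hc.le, dist_comm, dist_eq_norm, inv_eq_one_div,
      lt_div_iff₀ hc, mul_comm]
  by_cases hxy : dist x y < c⁻¹
  · rw [if_pos hxy, if_pos (this.mpr hxy)]
    ring
  · rw [if_neg hxy, if_neg (mt this.mp hxy)]
    ring

/-- The second moment of a linear form over the unit ball. -/
def ballMoment {d : ℕ} (w : EuclideanSpace ℝ (Fin d)) : ℝ≥0∞ :=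
  ∫⁻ z : EuclideanSpace ℝ (Fin d), ENNReal.ofReal ((inner ℝ w z) ^ 2 * if ‖z‖ < 1 then 1 else 0)

lemma ballMoment_eq {d : ℕ} (w : EuclideanSpace ℝ (Fin d)) {e : EuclideanSpace ℝ (Fin d)}
    (he : ‖e‖ = 1) : ballMoment w = ENNReal.ofReal (‖w‖ ^ 2) * ballMoment e := by
  have hn : ‖w‖ = ‖‖w‖ • e‖ := by rw [norm_smul, he]; simp
  let τ := (ℝ ∙ (w - ‖w‖ • e))ᗮ.reflection
  have hτ : τ w = ‖w‖ • e := Submodule.reflection_sub hn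
  have hm : ∀ u : EuclideanSpace ℝ (Fin d), Measurable fun z : EuclideanSpace ℝ (Fin d) =>
      ENNReal.ofReal ((inner ℝ u z) ^ 2 * if ‖z‖ < 1 then 1 else 0) := by
    intro u
    apply Measurable.ennreal_ofReal
    apply Measurable.mul (by fun_prop) measurable_ite_norm_lt_one
  have h1 : ballMoment (τ w) = ballMoment w := by
    rw [ballMoment, ← τ.measurePreserving.lintegral_comp (hm (τ w))]
    refine lintegral_congr fun z => ?_
    rw [LinearIsometryEquiv.inner_map_map, LinearIsometryEquiv.norm_map]
  rw [← h1, hτ, ballMoment, ballMoment, ← lintegral_const_mul' _ _ ENNReal.ofReal_ne_top]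
  refine lintegral_congr fun z => ?_
  rw [← ENNReal.ofReal_mul (by positivity), inner_smul_left]
  congr 1
  simp only [conj_trivial]
  ring

lemma ballMoment_ne_top {d : ℕ} {e : EuclideanSpace ℝ (Fin d)} (he : ‖e‖ = 1) :
    ballMoment e ≠ ∞ := by
  have h1 : ballMoment e ≤
      ∫⁻ z, (ball (0 : EuclideanSpace ℝ (Fin d)) 1).indicator (fun _ => 1) z := by
    refine lintegral_mono fun z => ?_
    by_cases hz : ‖z‖ < 1
    · rw [indicator_of_mem (by simpa using hz), if_pos hz, mul_one]
      rw [← ENNReal.ofReal_one]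
      apply ENNReal.ofReal_le_ofReal
      have := abs_real_inner_le_norm e z
      rw [he, one_mul] at this
      rw [← sq_abs]
      nlinarith [abs_nonneg (inner ℝ e z)]
    · simp [hz]
  refine ne_top_of_le_ne_top ?_ h1
  rw [lintegral_indicator measurableSet_ball]
  simp [measure_ball_lt_top.ne]

lemma ballMoment_ne_zero {d : ℕ} {e : EuclideanSpace ℝ (Fin d)} (he : ‖e‖ = 1) :
    ballMoment e ≠ 0 := by
  intro h0
  have hm : Measurable fun z : EuclideanSpace ℝ (Fin d) =>
      ENNReal.ofReal ((inner ℝ e z) ^ 2 * if ‖z‖ < 1 then 1 else 0) := by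
    apply Measurable.ennreal_ofReal
    apply Measurable.mul (by fun_prop) measurable_ite_norm_lt_one
  rw [ballMoment, lintegral_eq_zero_iff hm] at h0
  have hb : volume (ball ((1 / 2 : ℝ) • e) (1 / 4)) = 0 := by
    refine measure_mono_null (fun z hz => ?_) (ae_iff.mp h0)
    rw [mem_ball, dist_eq_norm] at hz
    have h1 := abs_real_inner_le_norm e (z - (1 / 2 : ℝ) • e)
    rw [he, inner_sub_right, inner_smul_right, real_inner_self_eq_norm_sq, he] at h1
    have h2 : ‖z‖ ≤ ‖z - (1 / 2 : ℝ) • e‖ + ‖(1 / 2 : ℝ) • e‖ := norm_le_norm_sub_add _ _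
    rw [norm_smul, he] at h2
    norm_num at h2 h1
    have h3 := (abs_le.mp h1).1
    have h4 : 0 < inner ℝ e z := by linarith
    have h5 : ‖z‖ < 1 := by linarith
    have h6 : 0 < inner ℝ e z ^ 2 := by positivity
    simpa [h5] using h6
  exact (measure_ball_pos volume _ (by norm_num)).ne' hb

lemma fderiv_apply_eq_inner_gradient {d : ℕ} (v : EuclideanSpace ℝ (Fin d) → ℝ)
    (x z : EuclideanSpace ℝ (Fin d)) : fderiv ℝ v x z = inner ℝ (gradient v x) z := by
  simp [gradient]

lemma norm_gradient {d : ℕ} (v : EuclideanSpace ℝ (Fin d) → ℝ) (x : EuclideanSpace ℝ (Fin d)) :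
    ‖gradient v x‖ = ‖fderiv ℝ v x‖ := by
  simp [gradient]

lemma measurable_scaledIntegrand {d : ℕ} (c : ℝ) {v : EuclideanSpace ℝ (Fin d) → ℝ}
    (hv : Measurable v) : Measurable (Function.uncurry (scaledIntegrand c v)) := by
  apply Measurable.ennreal_ofReal
  apply Measurable.mul
  · fun_prop
  · exact measurable_ite_norm_lt_one.comp measurable_snd

lemma scaledIntegrand_le {d : ℕ} {c : ℝ} (hc : 0 < c) {v : EuclideanSpace ℝ (Fin d) → ℝ}
    {K : NNReal} (hv : LipschitzWith K v) (x z : EuclideanSpace ℝ (Fin d)) :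
    scaledIntegrand c v x z ≤
      (ball (0 : EuclideanSpace ℝ (Fin d)) 1).indicator (fun _ => ENNReal.ofReal (K ^ 2)) z := by
  by_cases hz : ‖z‖ < 1
  · rw [indicator_of_mem (by simpa using hz), scaledIntegrand, if_pos hz, mul_one]
    apply ENNReal.ofReal_le_ofReal
    rw [← sq_abs]
    apply pow_le_pow_left₀ (abs_nonneg _)
    rw [abs_mul, abs_of_pos hc, ← Real.dist_eq]
    have h1 := hv.dist_le_mul (x + c⁻¹ • z) x
    rw [dist_self_add_left, norm_smul, Real.norm_of_nonneg (inv_nonneg.2 hc.le)] at h1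
    calc c * dist (v (x + c⁻¹ • z)) (v x)
        ≤ c * (K * (c⁻¹ * ‖z‖)) := by gcongr
      _ = K * ‖z‖ := by field_simp
      _ ≤ K := by nlinarith [K.coe_nonneg]
  · simp [scaledIntegrand, hz]

lemma scaledIntegrand_eq_zero {d : ℕ} {c : ℝ} (hc : 1 ≤ c) {v : EuclideanSpace ℝ (Fin d) → ℝ}
    {R : ℝ} (hR : ∀ x, R < ‖x‖ → v x = 0) {x : EuclideanSpace ℝ (Fin d)} (hx : R + 1 < ‖x‖)
    (z : EuclideanSpace ℝ (Fin d)) : scaledIntegrand c v x z = 0 := by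
  by_cases hz : ‖z‖ < 1
  · have h1 : v x = 0 := hR x (by linarith)
    have h2 : v (x + c⁻¹ • z) = 0 := by
      apply hR
      have h0 : 0 ≤ c⁻¹ := inv_nonneg.2 (by linarith)
      have h3 : ‖c⁻¹ • z‖ ≤ 1 := by
        rw [norm_smul, Real.norm_of_nonneg h0]
        have : c⁻¹ ≤ 1 := inv_le_one_of_one_le₀ hc
        nlinarith [norm_nonneg z]
      have h4 := norm_sub_norm_le x (-(c⁻¹ • z))
      rw [sub_neg_eq_add, norm_neg] at h4
      linarith
    simp [scaledIntegrand, h1, h2]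
  · simp [scaledIntegrand, hz]

lemma tendsto_lintegral_scaledIntegrand {d : ℕ} {e : EuclideanSpace ℝ (Fin d)} (he : ‖e‖ = 1)
    {v : EuclideanSpace ℝ (Fin d) → ℝ} {K : NNReal} (hv : LipschitzWith K v)
    {x : EuclideanSpace ℝ (Fin d)} (hx : DifferentiableAt ℝ v x) :
    Tendsto (fun n : ℕ => ∫⁻ z, scaledIntegrand (n + 1 : ℝ) v x z) atTop
      (nhds (ENNReal.ofReal (‖gradient v x‖ ^ 2) * ballMoment e)) := by
  have hm : ∀ n : ℕ, Measurable (scaledIntegrand (n + 1 : ℝ) v x) := fun n =>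
    (measurable_scaledIntegrand _ hv.continuous.measurable).of_uncurry_left
  rw [← ballMoment_eq _ he]
  refine tendsto_lintegral_of_dominated_convergence
    ((ball (0 : EuclideanSpace ℝ (Fin d)) 1).indicator (fun _ => ENNReal.ofReal (K ^ 2)))
    (fun n => hm n)
    (fun n => Eventually.of_forall fun z => scaledIntegrand_le (by positivity) hv x z) ?_
    (Eventually.of_forall fun z => ?_)
  · rw [lintegral_indicator measurableSet_ball]
    simp only [lintegral_const]
    exact ENNReal.mul_ne_top ENNReal.ofReal_ne_top (by simp [measure_ball_lt_top.ne])
  · have hn : Tendsto (fun n : ℕ => ‖(n : ℝ) + 1‖) atTop atTop := by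
      have : ∀ n : ℕ, ‖((n : ℝ) + 1)‖ = n + 1 := fun n => Real.norm_of_nonneg (by positivity)
      simp_rw [this]
      exact tendsto_atTop_add_const_right _ _ tendsto_natCast_atTop_atTop
    have hl := hx.hasFDerivAt.lim z hn
    rw [fderiv_apply_eq_inner_gradient] at hl
    exact ENNReal.tendsto_ofReal ((hl.pow 2).mul_const _)

lemma tendsto_scaledEnergy {d : ℕ} {e : EuclideanSpace ℝ (Fin d)} (he : ‖e‖ = 1)
    {v : EuclideanSpace ℝ (Fin d) → ℝ} {K : NNReal} (hv : LipschitzWith K v) {R : ℝ}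
    (hR : ∀ x, R < ‖x‖ → v x = 0) :
    Tendsto (fun n : ℕ => scaledEnergy (n + 1 : ℝ) v) atTop
      (nhds ((∫⁻ x, ENNReal.ofReal (‖gradient v x‖ ^ 2)) * ballMoment e)) := by
  set C : ℝ≥0∞ := ∫⁻ z, (ball (0 : EuclideanSpace ℝ (Fin d)) 1).indicator
    (fun _ => ENNReal.ofReal (K ^ 2)) z with hC
  have hCtop : C ≠ ∞ := by
    rw [hC, lintegral_indicator measurableSet_ball]
    simp only [lintegral_const]
    exact ENNReal.mul_ne_top ENNReal.ofReal_ne_top (by simp [measure_ball_lt_top.ne])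
  have hm : ∀ n : ℕ, Measurable fun x => ∫⁻ z, scaledIntegrand (n + 1 : ℝ) v x z := fun n =>
    (measurable_scaledIntegrand _ hv.continuous.measurable).lintegral_prod_right'
  rw [← lintegral_mul_const' _ _ (ballMoment_ne_top he)]
  refine tendsto_lintegral_of_dominated_convergence
    ((closedBall (0 : EuclideanSpace ℝ (Fin d)) (R + 1)).indicator fun _ => C)
    (fun n => hm n)
    (fun n => Eventually.of_forall fun x => ?_) ?_ ?_
  · by_cases hx : R + 1 < ‖x‖
    · have : ∫⁻ z, scaledIntegrand (n + 1 : ℝ) v x z = 0 := by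
        simp [scaledIntegrand_eq_zero (c := (n + 1 : ℝ)) (by simp) hR hx]
      exact this.le.trans zero_le
    · rw [indicator_of_mem (by simpa using hx)]
      exact lintegral_mono (scaledIntegrand_le (by positivity) hv x)
  · rw [lintegral_indicator measurableSet_closedBall]
    simp only [lintegral_const]
    exact ENNReal.mul_ne_top hCtop (by simp [measure_closedBall_lt_top.ne])
  · filter_upwards [hv.ae_differentiableAt] with x hx
      using tendsto_lintegral_scaledIntegrand he hv hx

lemma gradient_eq_zero_of_eventuallyEq {d : ℕ} {v : EuclideanSpace ℝ (Fin d) → ℝ}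
    {x : EuclideanSpace ℝ (Fin d)} (h : v =ᶠ[nhds x] fun _ => 0) : gradient v x = 0 := by
  have : fderiv ℝ v x = 0 := by rw [h.fderiv_eq]; simp
  simp [gradient, this]

lemma integrable_norm_gradient_sq {d : ℕ} {v : EuclideanSpace ℝ (Fin d) → ℝ} {K : NNReal}
    (hv : LipschitzWith K v) {R : ℝ} (hR : ∀ x, R < ‖x‖ → v x = 0) :
    Integrable fun x => ‖gradient v x‖ ^ 2 := by
  have hm : Measurable fun x => ‖gradient v x‖ ^ 2 := by
    simp_rw [norm_gradient]
    exact (measurable_fderiv ℝ v).norm.pow_const 2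
  have h1 : IntegrableOn (fun x => ‖gradient v x‖ ^ 2) (closedBall 0 R) := by
    refine Measure.integrableOn_of_bounded (M := (K : ℝ) ^ 2) measure_closedBall_lt_top.ne
      hm.aestronglyMeasurable (Eventually.of_forall fun x => ?_)
    rw [norm_gradient, norm_pow, norm_norm]
    exact pow_le_pow_left₀ (norm_nonneg _) (norm_fderiv_le_of_lipschitz ℝ hv) 2
  rw [← integrableOn_univ]
  refine h1.of_forall_sdiff_eq_zero MeasurableSet.univ fun x hx => ?_
  have hx' : R < ‖x‖ := by simpa using hx.2
  rw [gradient_eq_zero_of_eventuallyEq]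
  · simp
  · filter_upwards [(isOpen_lt continuous_const continuous_norm).mem_nhds hx'] with y hy
      using hR y hy

/-- Comparison of difference energies at all scales yields comparison of Dirichlet energies. -/
lemma integral_gradient_sq_le_of_diffEnergy_le {d : ℕ} (hd : 0 < d)
    {u v : EuclideanSpace ℝ (Fin d) → ℝ} {K : NNReal} (hu : LipschitzWith K u)
    (hv : LipschitzWith K v) {R : ℝ} (huR : ∀ x, R < ‖x‖ → u x = 0)
    (hvR : ∀ x, R < ‖x‖ → v x = 0) (h : ∀ δ, diffEnergy δ v ≤ diffEnergy δ u) :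
    ∫ x, ‖gradient v x‖ ^ 2 ≤ ∫ x, ‖gradient u x‖ ^ 2 := by
  obtain ⟨e, he⟩ : ∃ e : EuclideanSpace ℝ (Fin d), ‖e‖ = 1 :=
    ⟨EuclideanSpace.single ⟨0, hd⟩ 1, by simp⟩
  have h1 : (∫⁻ x, ENNReal.ofReal (‖gradient v x‖ ^ 2)) * ballMoment e ≤
      (∫⁻ x, ENNReal.ofReal (‖gradient u x‖ ^ 2)) * ballMoment e := by
    refine le_of_tendsto_of_tendsto' (tendsto_scaledEnergy he hv hvR)
      (tendsto_scaledEnergy he hu huR) fun n => ?_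
    rw [scaledEnergy_eq (by positivity) hu.continuous.measurable,
      scaledEnergy_eq (by positivity) hv.continuous.measurable]
    gcongr
    exact h _
  have h2 := (ENNReal.mul_le_mul_iff_left (ballMoment_ne_zero he) (ballMoment_ne_top he)).mp h1
  have iu := integrable_norm_gradient_sq hu huR
  have iv := integrable_norm_gradient_sq hv hvR
  have p : ∀ w : EuclideanSpace ℝ (Fin d) → ℝ, 0 ≤ᵐ[volume] fun x => ‖gradient w x‖ ^ 2 :=
    fun w => Eventually.of_forall fun x => by positivity
  rw [integral_eq_lintegral_of_nonneg_ae (p u) iu.aestronglyMeasurable,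
    integral_eq_lintegral_of_nonneg_ae (p v) iv.aestronglyMeasurable]
  refine ENNReal.toReal_mono ?_ h2
  rw [← ofReal_integral_eq_lintegral_ofReal iu (p u)]
  exact ENNReal.ofReal_ne_top

/-! ### Schwarz symmetrization -/

lemma exists_tendsto_subseq_of_lipschitzWith {d : ℕ} {K : NNReal} {M : ℝ}
    {f : ℕ → EuclideanSpace ℝ (Fin d) → ℝ} (hf : ∀ n, LipschitzWith K (f n))
    (hM : ∀ n x, f n x ∈ Icc 0 M) :
    ∃ (φ : ℕ → ℕ) (g : EuclideanSpace ℝ (Fin d) → ℝ), LipschitzWith K g ∧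
      ∀ x, Tendsto (fun n => f (φ n) x) atTop (nhds (g x)) ∧ StrictMono φ := by
  let S : Set C(EuclideanSpace ℝ (Fin d), ℝ) := {g | LipschitzWith K g ∧ ∀ x, g x ∈ Icc 0 M}
  have himage : ContinuousMap.toFun '' S =
      {g | ∀ x y, dist (g x) (g y) ≤ K * dist x y} ∩ Set.pi univ fun _ => Icc 0 M := by
    ext g
    constructor
    · rintro ⟨g', ⟨h1, h2⟩, rfl⟩
      exact ⟨h1.dist_le_mul, fun x _ => h2 x⟩
    · rintro ⟨h1, h2⟩
      have h3 : LipschitzWith K g := LipschitzWith.of_dist_le_mul h1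
      exact ⟨⟨g, h3.continuous⟩, ⟨h3, fun x => h2 x (mem_univ x)⟩, rfl⟩
  have hclosed : IsClosed {g : EuclideanSpace ℝ (Fin d) → ℝ |
      ∀ x y, dist (g x) (g y) ≤ K * dist x y} := by
    simp only [ofPred_forall]
    exact isClosed_iInter fun x => isClosed_iInter fun y =>
      isClosed_le ((continuous_apply x).dist (continuous_apply y)) continuous_const
  have hS : IsCompact S := by
    apply ArzelaAscoli.isCompact_of_equicontinuous
    · rw [himage]
      exact (isCompact_univ_pi fun _ => isCompact_Icc).inter_left hclosed
    · exact (LipschitzWith.uniformEquicontinuous _ K fun g => g.2.1).equicontinuous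
  obtain ⟨g, hg, φ, hφ, hlim⟩ := hS.tendsto_subseq
    (x := fun n => ⟨f n, (hf n).continuous⟩) fun n => ⟨hf n, hM n⟩
  refine ⟨φ, g, hg.1, fun x => ⟨?_, hφ⟩⟩
  exact ((continuous_eval_const x).tendsto g).comp hlim

/-- The functions competing with `u` in the construction of its symmetrization. -/
structure IsRearrangement {d : ℕ} (K : NNReal) (R M : ℝ)
    (u v : EuclideanSpace ℝ (Fin d) → ℝ) : Prop where
  lip : LipschitzWith K v
  mem : ∀ x, v x ∈ Icc 0 M
  vanish : ∀ x, R < ‖x‖ → v x = 0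
  moments : ∀ p : ℕ, 0 < p → ∫⁻ x, ENNReal.ofReal (v x ^ p) = ∫⁻ x, ENNReal.ofReal (u x ^ p)
  supp : volume {x | 0 < v x} ≤ volume {x | 0 < u x}
  energy : ∀ δ, diffEnergy δ v ≤ diffEnergy δ u

lemma lintegral_ite_pos {d : ℕ} {v : EuclideanSpace ℝ (Fin d) → ℝ} (hv : Measurable v) :
    ∫⁻ x, (if 0 < v x then 1 else 0 : ℝ≥0∞) = volume {x | 0 < v x} := by
  have hs : MeasurableSet {x | 0 < v x} := measurableSet_lt measurable_const hv
  rw [← lintegral_indicator_one hs]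
  refine lintegral_congr fun x => ?_
  simp [indicator]

lemma IsRearrangement.polarization {d : ℕ} {K : NNReal} {R M : ℝ}
    {u v : EuclideanSpace ℝ (Fin d) → ℝ} (hv : IsRearrangement K R M u v)
    {σ : EuclideanSpace ℝ (Fin d) → EuclideanSpace ℝ (Fin d)} {h : EuclideanSpace ℝ (Fin d) → ℝ}
    (H : IsHyperplaneReflection σ h) (hσ : ∀ x, 0 ≤ h x → ‖x‖ ≤ ‖σ x‖) :
    IsRearrangement K R M u (polarize σ h v) := by
  have hl := H.lipschitzWith_polarize hv.lip
  have hm := hv.lip.continuous.measurable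
  have hlm := hl.continuous.measurable
  refine ⟨hl, fun x => ?_, fun x hx => ?_, fun p hp => ?_, ?_, fun δ => ?_⟩
  · rcases H.polarize_pair v x with h1 | h1 <;> rw [h1.1] <;> exact hv.mem _
  · rcases le_total 0 (h x) with h1 | h1
    · rw [(H.polarize_of_nonneg v h1).1, hv.vanish x hx, hv.vanish _ (hx.trans_le (hσ x h1))]
      simp
    · rw [(H.polarize_of_nonpos v h1).1, hv.vanish x hx]
      exact min_eq_left (hv.mem _).1
  · rw [← hv.moments p hp]
    exact H.lintegral_comp_polarize hm hlm (φ := fun t => ENNReal.ofReal (t ^ p)) (by fun_prop)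
  · rw [← lintegral_ite_pos hlm]
    rw [H.lintegral_comp_polarize hm hlm (φ := fun t => if 0 < t then 1 else 0)
      (Measurable.ite measurableSet_Ioi measurable_const measurable_const), lintegral_ite_pos hm]
    exact hv.supp
  · exact (H.diffEnergy_polarize_le hm hlm δ).trans (hv.energy δ)

lemma IsRearrangement.of_tendsto {d : ℕ} {K : NNReal} {R M : ℝ}
    {u v : EuclideanSpace ℝ (Fin d) → ℝ} {f : ℕ → EuclideanSpace ℝ (Fin d) → ℝ}
    (hf : ∀ n, IsRearrangement K R M u (f n)) (hv : LipschitzWith K v)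
    (hlim : ∀ x, Tendsto (fun n => f n x) atTop (nhds (v x))) : IsRearrangement K R M u v := by
  have hfm : ∀ n, Measurable (f n) := fun n => (hf n).lip.continuous.measurable
  have hmem : ∀ x, v x ∈ Icc 0 M := fun x =>
    isClosed_Icc.mem_of_tendsto (hlim x) (Eventually.of_forall fun n => (hf n).mem x)
  refine ⟨hv, hmem, fun x hx => ?_, fun p hp => ?_, ?_, fun δ => ?_⟩
  · refine tendsto_nhds_unique (hlim x) ?_
    simp [(hf _).vanish x hx]
  · have h1 : Tendsto (fun n => ∫⁻ x, ENNReal.ofReal (f n x ^ p)) atTop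
        (nhds (∫⁻ x, ENNReal.ofReal (v x ^ p))) := by
      refine tendsto_lintegral_of_dominated_convergence
        ((closedBall (0 : EuclideanSpace ℝ (Fin d)) R).indicator fun _ => ENNReal.ofReal (M ^ p))
        (fun n => ((hfm n).pow_const p).ennreal_ofReal)
        (fun n => Eventually.of_forall fun x => ?_) ?_ (Eventually.of_forall fun x => ?_)
      · by_cases hx : R < ‖x‖
        · simp [(hf n).vanish x hx, hp.ne']
        · rw [indicator_of_mem (by simpa using hx)]
          exact ENNReal.ofReal_le_ofReal (pow_le_pow_left₀ ((hf n).mem x).1 ((hf n).mem x).2 p)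
      · rw [lintegral_indicator measurableSet_closedBall]
        simp only [lintegral_const]
        exact ENNReal.mul_ne_top ENNReal.ofReal_ne_top (by simp [measure_closedBall_lt_top.ne])
      · exact ENNReal.tendsto_ofReal ((hlim x).pow p)
    refine tendsto_nhds_unique h1 ?_
    simp [(hf _).moments p hp]
  · rw [← lintegral_ite_pos hv.continuous.measurable]
    calc ∫⁻ x, (if 0 < v x then 1 else 0 : ℝ≥0∞)
        ≤ ∫⁻ x, liminf (fun n => (if 0 < f n x then 1 else 0 : ℝ≥0∞)) atTop := by
          refine lintegral_mono fun x => ?_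
          by_cases hx : 0 < v x
          · simp only [hx, if_true]
            refine le_liminf_of_le (by isBoundedDefault) ?_
            filter_upwards [(hlim x).eventually_const_lt hx] with n hn
            simp [hn]
          · simp [hx]
      _ ≤ liminf (fun n => ∫⁻ x, (if 0 < f n x then 1 else 0 : ℝ≥0∞)) atTop :=
          lintegral_liminf_le fun n => Measurable.ite (measurableSet_lt measurable_const (hfm n))
            measurable_const measurable_const
      _ ≤ volume {x | 0 < u x} := by
          refine liminf_le_of_le (by isBoundedDefault) fun b hb => ?_
          obtain ⟨n, hn⟩ := hb.exists
          rw [lintegral_ite_pos (hfm n)] at hn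
          exact hn.trans (hf n).supp
  · have hm : ∀ n, Measurable (Function.uncurry fun x y : EuclideanSpace ℝ (Fin d) =>
        ENNReal.ofReal ((f n x - f n y) ^ 2 * if dist x y < δ then 1 else 0)) := fun n =>
      IsHyperplaneReflection.measurable_diffEnergy_integrand (hfm n)
    calc diffEnergy δ v
        ≤ ∫⁻ x, liminf (fun n => ∫⁻ y,
            ENNReal.ofReal ((f n x - f n y) ^ 2 * if dist x y < δ then 1 else 0)) atTop := by
          refine lintegral_mono fun x => le_trans ?_ (lintegral_liminf_le fun n =>
            (hm n).of_uncurry_left)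
          refine lintegral_mono fun y => ?_
          refine (Tendsto.liminf_eq ?_).ge
          exact ENNReal.tendsto_ofReal ((((hlim x).sub (hlim y)).pow 2).mul_const _)
      _ ≤ liminf (fun n => diffEnergy δ (f n)) atTop :=
          lintegral_liminf_le fun n => (hm n).lintegral_prod_right'
      _ ≤ diffEnergy δ u := by
          refine liminf_le_of_le (by isBoundedDefault) fun b hb => ?_
          obtain ⟨n, hn⟩ := hb.exists
          exact hn.trans ((hf n).energy δ)

lemma integrable_of_continuous_of_vanish {d : ℕ} {f : EuclideanSpace ℝ (Fin d) → ℝ}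
    (hf : Continuous f) {R : ℝ} (hR : ∀ x, R < ‖x‖ → f x = 0) : Integrable f := by
  refine hf.integrable_of_hasCompactSupport (HasCompactSupport.intro (isCompact_closedBall 0 R) ?_)
  intro x hx
  exact hR x (by simpa using hx)

lemma exists_rearrangement_minimizing {d : ℕ} {K : NNReal} {R M : ℝ}
    {u : EuclideanSpace ℝ (Fin d) → ℝ} (hu : IsRearrangement K R M u u) :
    ∃ v, IsRearrangement K R M u v ∧
      ∀ w, IsRearrangement K R M u w → ∫ x, v x * ‖x‖ ^ 2 ≤ ∫ x, w x * ‖x‖ ^ 2 := by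
  let S : Set ℝ := (fun w : EuclideanSpace ℝ (Fin d) → ℝ => ∫ x, w x * ‖x‖ ^ 2) ''
    {w | IsRearrangement K R M u w}
  have hS0 : S.Nonempty := ⟨_, u, hu, rfl⟩
  have hSb : BddBelow S := by
    refine ⟨0, ?_⟩
    rintro _ ⟨w, hw, rfl⟩
    exact integral_nonneg fun x => mul_nonneg (hw.mem x).1 (by positivity)
  obtain ⟨s, -, hs, hsS⟩ := exists_seq_tendsto_sInf hS0 hSb
  choose f hf hfs using hsS
  obtain ⟨φ, v, hv, hφ⟩ := exists_tendsto_subseq_of_lipschitzWith (fun n => (hf n).lip)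
    fun n => (hf n).mem
  have hV : IsRearrangement K R M u v :=
    IsRearrangement.of_tendsto (fun n => hf (φ n)) hv fun x => (hφ x).1
  refine ⟨v, hV, fun w hw => ?_⟩
  have h1 : Tendsto (fun n => ∫ x, f (φ n) x * ‖x‖ ^ 2) atTop (nhds (∫ x, v x * ‖x‖ ^ 2)) := by
    refine tendsto_integral_of_dominated_convergence
      ((closedBall (0 : EuclideanSpace ℝ (Fin d)) R).indicator fun _ => M * R ^ 2) (fun n => ?_) ?_
      (fun n => Eventually.of_forall fun x => ?_)
      (Eventually.of_forall fun x => (hφ x).1.mul_const _)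
    · exact ((hf (φ n)).lip.continuous.mul (by fun_prop)).aestronglyMeasurable
    · exact (integrable_indicator_iff measurableSet_closedBall).2
        (integrableOn_const measure_closedBall_lt_top.ne)
    · have h2 := (hf (φ n)).mem x
      rw [Real.norm_of_nonneg (mul_nonneg h2.1 (by positivity))]
      by_cases hx : R < ‖x‖
      · simp [(hf (φ n)).vanish x hx, indicator, hx.not_ge]
      · rw [indicator_of_mem (by simpa using hx)]
        exact mul_le_mul h2.2 (pow_le_pow_left₀ (norm_nonneg _) (not_lt.mp hx) 2) (by positivity)
          (h2.1.trans h2.2)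
  have h3 : Tendsto (fun n => ∫ x, f (φ n) x * ‖x‖ ^ 2) atTop (nhds (sInf S)) := by
    have := hs.comp (hφ 0).2.tendsto_atTop
    refine this.congr fun n => ?_
    exact (hfs (φ n)).symm
  rw [tendsto_nhds_unique h1 h3]
  exact csInf_le hSb ⟨w, hw, rfl⟩

lemma IsRearrangement.le_of_minimizing {d : ℕ} {K : NNReal} {R M : ℝ}
    {u v : EuclideanSpace ℝ (Fin d) → ℝ} (hv : IsRearrangement K R M u v)
    (hmin : ∀ w, IsRearrangement K R M u w → ∫ x, v x * ‖x‖ ^ 2 ≤ ∫ x, w x * ‖x‖ ^ 2)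
    {a b : EuclideanSpace ℝ (Fin d)} (hab : ‖a‖ < ‖b‖) : v b ≤ v a := by
  obtain ⟨σ, h, H, hσa, ha, c, hc, hn⟩ := exists_hyperplaneReflection hab
  have hσ : ∀ x, 0 ≤ h x → ‖x‖ ≤ ‖σ x‖ := fun x hx =>
    le_of_sq_le_sq (by rw [hn]; nlinarith) (norm_nonneg _)
  have hw := hv.polarization H hσ
  set w := polarize σ h v with hwdef
  have hσc : Continuous σ := (Isometry.of_dist_eq H.isom).continuous
  let D : EuclideanSpace ℝ (Fin d) → ℝ := fun x => (v x - w x) * (‖x‖ ^ 2 - ‖σ x‖ ^ 2)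
  have hDc : Continuous D := by
    have := hv.lip.continuous
    have := hw.lip.continuous
    fun_prop
  have hD0 : ∀ x, 0 ≤ D x := by
    intro x
    simp only [D, hn, hwdef]
    rcases le_total 0 (h x) with hx | hx
    · rw [(H.polarize_of_nonneg v hx).1]
      have := le_max_left (v x) (v (σ x))
      nlinarith [mul_nonneg (sub_nonneg.2 this) (mul_nonneg hc.le hx)]
    · rw [(H.polarize_of_nonpos v hx).1]
      have := min_le_left (v x) (v (σ x))
      nlinarith [mul_nonneg (sub_nonneg.2 this) (mul_nonneg hc.le (neg_nonneg.2 hx))]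
  have hDi : Integrable D := integrable_of_continuous_of_vanish hDc (R := R) fun x hx => by
    simp [D, hv.vanish x hx, hw.vanish x hx]
  let F : EuclideanSpace ℝ (Fin d) → ℝ := fun x => (v x - w x) * ‖x‖ ^ 2
  have hiv : Integrable fun x => v x * ‖x‖ ^ 2 :=
    integrable_of_continuous_of_vanish (hv.lip.continuous.mul (by fun_prop)) (R := R)
      fun x hx => by simp [hv.vanish x hx]
  have hiw : Integrable fun x => w x * ‖x‖ ^ 2 :=
    integrable_of_continuous_of_vanish (hw.lip.continuous.mul (by fun_prop)) (R := R)
      fun x hx => by simp [hw.vanish x hx]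
  have hF : F = fun x => v x * ‖x‖ ^ 2 - w x * ‖x‖ ^ 2 := by
    funext x
    simp only [F]
    ring
  have hFi : Integrable F := by
    rw [hF]
    exact hiv.sub hiw
  have hFσ : ∫ x, F (σ x) = ∫ x, F x := by
    have := integral_map (μ := volume) H.mp.measurable.aemeasurable (f := F)
      (by rw [H.mp.map_eq]; exact hFi.aestronglyMeasurable)
    rw [← this, H.mp.map_eq]
  have hFσi : Integrable fun x => F (σ x) := H.mp.integrable_comp_of_integrable hFi
  have hDF : ∀ x, D x = F x + F (σ x) := by
    intro x
    have : v x - w x = -(v (σ x) - w (σ x)) := by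
      rcases H.polarize_pair v x with h1 | h1 <;> rw [hwdef, h1.1, h1.2] <;> ring
    simp only [D, F]
    rw [this]
    ring
  have hint : ∫ x, D x ≤ 0 := by
    simp_rw [hDF]
    rw [integral_add hFi hFσi, hFσ, hF, integral_sub hiv hiw]
    linarith [hmin w hw]
  have hDzero : D = fun _ => 0 := by
    have h1 : ∫ x, D x = 0 := le_antisymm hint (integral_nonneg hD0)
    rw [integral_eq_zero_iff_of_nonneg hD0 hDi] at h1
    exact hDc.ae_eq_iff_eq volume continuous_const |>.mp h1
  have h2 := congrFun hDzero a
  simp only [D, hn, hwdef, (H.polarize_of_nonneg v ha.le).1, hσa] at h2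
  have h3 : v a - max (v a) (v b) = 0 := by
    have : ‖a‖ ^ 2 - (‖a‖ ^ 2 + c * h a) ≠ 0 := by
      have := mul_pos hc ha
      linarith
    exact (mul_eq_zero.mp h2).resolve_right this
  have := le_max_right (v a) (v b)
  linarith

/-- Schwarz symmetrization of a nonnegative compactly supported Lipschitz function, with the
Pólya–Szegő inequality. -/
theorem exists_schwarz_symmetrization {d : ℕ} (hd : 0 < d) {u : EuclideanSpace ℝ (Fin d) → ℝ}
    {K : NNReal} (hu : LipschitzWith K u) (h0 : ∀ x, 0 ≤ u x) {R : ℝ}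
    (hR : ∀ x, R < ‖x‖ → u x = 0) {r : ℝ} (hr : 0 < r)
    (hvol : volume {x | 0 < u x} ≤ volume (ball (0 : EuclideanSpace ℝ (Fin d)) r)) :
    ∃ v : EuclideanSpace ℝ (Fin d) → ℝ, LipschitzWith K v ∧ (∀ x, 0 ≤ v x) ∧
      (∀ x, r ≤ ‖x‖ → v x = 0) ∧ ∫ x, v x = ∫ x, u x ∧ ∫ x, v x ^ 2 = ∫ x, u x ^ 2 ∧
      ∫ x, ‖gradient v x‖ ^ 2 ≤ ∫ x, ‖gradient u x‖ ^ 2 := by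
  have : Nontrivial (EuclideanSpace ℝ (Fin d)) := by
    have : Nonempty (Fin d) := ⟨⟨0, hd⟩⟩
    infer_instance
  obtain ⟨M, hM⟩ := (isCompact_closedBall (0 : EuclideanSpace ℝ (Fin d)) R).exists_bound_of_continuousOn
    hu.continuous.continuousOn
  have hmem : ∀ x, u x ∈ Icc 0 (max M 0) := by
    intro x
    refine ⟨h0 x, ?_⟩
    by_cases hx : R < ‖x‖
    · rw [hR x hx]
      exact le_max_right _ _
    · exact ((le_abs_self _).trans (hM x (by simpa using hx))).trans (le_max_left _ _)
  obtain ⟨v, hv, hmin⟩ := exists_rearrangement_minimizing (K := K) (R := R) (M := max M 0) (u := u)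
    ⟨hu, hmem, hR, fun _ _ => rfl, le_rfl, fun _ => le_rfl⟩
  have hint : ∀ p : ℕ, 0 < p → ∫ x, v x ^ p = ∫ x, u x ^ p := by
    intro p hp
    rw [integral_eq_lintegral_of_nonneg_ae
        (Eventually.of_forall fun x => pow_nonneg (hv.mem x).1 p)
        (hv.lip.continuous.pow p).aestronglyMeasurable,
      integral_eq_lintegral_of_nonneg_ae (Eventually.of_forall fun x => pow_nonneg (h0 x) p)
        (hu.continuous.pow p).aestronglyMeasurable, hv.moments p hp]
  refine ⟨v, hv.lip, fun x => (hv.mem x).1, fun b hb => ?_, by simpa using hint 1 one_pos,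
    hint 2 two_pos, integral_gradient_sq_le_of_diffEnergy_le hd hu hv.lip hR hv.vanish hv.energy⟩
  by_contra hne
  have hpos : 0 < v b := (hv.mem b).1.lt_of_ne' hne
  have htend : Tendsto (fun t : ℝ => v (t • b)) (nhdsWithin 1 (Ioi 1)) (nhds (v b)) := by
    have h1 : Continuous fun t : ℝ => v (t • b) := hv.lip.continuous.comp (by fun_prop)
    have h2 := h1.tendsto 1
    simp only [one_smul] at h2
    exact h2.mono_left nhdsWithin_le_nhds
  obtain ⟨t, ht, ht1⟩ := ((htend.eventually_const_lt hpos).and self_mem_nhdsWithin).exists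
  have hlt : r < ‖t • b‖ := by
    rw [norm_smul, Real.norm_of_nonneg (by linarith [ht1])]
    nlinarith [ht1]
  have hsub : ball 0 ‖t • b‖ ⊆ {x | 0 < v x} := by
    intro x hx
    exact ht.trans_le (hv.le_of_minimizing hmin (by simpa using hx))
  have hle := ((measure_mono hsub).trans hv.supp).trans hvol
  rw [Measure.addHaar_ball _ _ (norm_nonneg _), Measure.addHaar_ball _ _ hr.le,
    ENNReal.mul_le_mul_iff_left (measure_ball_pos _ _ one_pos).ne' measure_ball_lt_top.ne,
    finrank_euclideanSpace_fin, ENNReal.ofReal_le_ofReal_iff (by positivity)] at hle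
  exact (pow_lt_pow_left₀ hlt hr.le hd.ne').not_ge hle

lemma norm_gradient_congr {d : ℕ} {u v : EuclideanSpace ℝ (Fin d) → ℝ}
    {x : EuclideanSpace ℝ (Fin d)} (h : u =ᶠ[nhds x] v) : ‖gradient u x‖ = ‖gradient v x‖ := by
  rw [norm_gradient, norm_gradient, h.fderiv_eq]

lemma norm_gradient_neg {d : ℕ} (v : EuclideanSpace ℝ (Fin d) → ℝ)
    (x : EuclideanSpace ℝ (Fin d)) : ‖gradient (fun y => -v y) x‖ = ‖gradient v x‖ := by
  rw [norm_gradient, norm_gradient, fderiv_fun_neg, norm_neg]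

lemma norm_gradient_sub_const {d : ℕ} (v : EuclideanSpace ℝ (Fin d) → ℝ) (s : ℝ)
    (x : EuclideanSpace ℝ (Fin d)) : ‖gradient (fun y => v y - s) x‖ = ‖gradient v x‖ := by
  rw [norm_gradient, norm_gradient, fderiv_sub_const]

lemma norm_gradient_const_mul {d : ℕ} (v : EuclideanSpace ℝ (Fin d) → ℝ) (t : ℝ)
    (x : EuclideanSpace ℝ (Fin d)) : ‖gradient (fun y => t * v y) x‖ = |t| * ‖gradient v x‖ := by
  have h : (fun y => t * v y) = t • v := rfl
  rw [norm_gradient, norm_gradient, h, fderiv_const_smul_field, Pi.smul_apply, norm_smul,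
    Real.norm_eq_abs]

lemma norm_gradient_comp_smul {d : ℕ} (v : EuclideanSpace ℝ (Fin d) → ℝ) (t : ℝ)
    (x : EuclideanSpace ℝ (Fin d)) :
    ‖gradient (fun y => v (t • y)) x‖ = |t| * ‖gradient v (t • x)‖ := by
  rw [norm_gradient, norm_gradient, fderiv_comp_smul, norm_smul, Real.norm_eq_abs]

lemma norm_gradient_comp_sub {d : ℕ} (v : EuclideanSpace ℝ (Fin d) → ℝ)
    (c x : EuclideanSpace ℝ (Fin d)) :
    ‖gradient (fun y => v (y - c)) x‖ = ‖gradient v (x - c)‖ := by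
  rw [norm_gradient, norm_gradient, fderiv_comp_sub]

lemma norm_gradient_posPart_add_negPart_le {d : ℕ} {v : EuclideanSpace ℝ (Fin d) → ℝ}
    (hv : Continuous v) (x : EuclideanSpace ℝ (Fin d)) :
    ‖gradient (fun y => max (v y) 0) x‖ ^ 2 + ‖gradient (fun y => max (-v y) 0) x‖ ^ 2 ≤
      ‖gradient v x‖ ^ 2 := by
  rcases lt_trichotomy (v x) 0 with hx | hx | hx
  · have h := hv.continuousAt.eventually_lt_const hx
    have h1 : (fun y => max (v y) 0) =ᶠ[nhds x] fun _ => 0 :=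
      h.mono fun y hy => max_eq_right hy.le
    have h2 : (fun y => max (-v y) 0) =ᶠ[nhds x] fun y => -v y :=
      h.mono fun y hy => max_eq_left (neg_nonneg.2 hy.le)
    rw [gradient_eq_zero_of_eventuallyEq h1, norm_gradient_congr h2, norm_gradient_neg]
    simp
  · have h1 : IsLocalMin (fun y => max (v y) 0) x :=
      Eventually.of_forall fun y => by simp [hx]
    have h2 : IsLocalMin (fun y => max (-v y) 0) x :=
      Eventually.of_forall fun y => by simp [hx]
    rw [norm_gradient, norm_gradient, h1.fderiv_eq_zero, h2.fderiv_eq_zero]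
    simp
  · have h := hv.continuousAt.eventually_const_lt hx
    have h1 : (fun y => max (-v y) 0) =ᶠ[nhds x] fun _ => 0 :=
      h.mono fun y hy => max_eq_right (neg_nonpos.2 hy.le)
    have h2 : (fun y => max (v y) 0) =ᶠ[nhds x] fun y => v y :=
      h.mono fun y hy => max_eq_left hy.le
    rw [gradient_eq_zero_of_eventuallyEq h1, norm_gradient_congr h2]
    simp

lemma norm_gradient_sub_max_zero_le {d : ℕ} {v : EuclideanSpace ℝ (Fin d) → ℝ}
    (hv : Continuous v) (s : ℝ) (x : EuclideanSpace ℝ (Fin d)) :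
    ‖gradient (fun y => max (v y - s) 0) x‖ ^ 2 ≤ ‖gradient v x‖ ^ 2 := by
  have := norm_gradient_posPart_add_negPart_le (v := fun y => v y - s) (by fun_prop) x
  rw [norm_gradient_sub_const] at this
  nlinarith [sq_nonneg ‖gradient (fun y => max (-(v y - s)) 0) x‖]

lemma norm_gradient_sub_sq {d : ℕ} {a b : EuclideanSpace ℝ (Fin d) → ℝ}
    {x : EuclideanSpace ℝ (Fin d)}
    (h : a =ᶠ[nhds x] (fun _ => 0) ∨ b =ᶠ[nhds x] fun _ => 0) :
    ‖gradient (fun y => a y - b y) x‖ ^ 2 = ‖gradient a x‖ ^ 2 + ‖gradient b x‖ ^ 2 := by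
  rcases h with h | h
  · have h1 : (fun y => a y - b y) =ᶠ[nhds x] fun y => -b y := h.mono fun y hy => by simp [hy]
    rw [gradient_eq_zero_of_eventuallyEq h, norm_gradient_congr h1, norm_gradient_neg]
    simp
  · have h1 : (fun y => a y - b y) =ᶠ[nhds x] fun y => a y := h.mono fun y hy => by simp [hy]
    rw [gradient_eq_zero_of_eventuallyEq h, norm_gradient_congr h1]
    simp

lemma integral_comp_smul_of_pos {d : ℕ} {t : ℝ} (ht : 0 < t)
    (f : EuclideanSpace ℝ (Fin d) → ℝ) : ∫ x, f (t • x) = (t ^ d)⁻¹ * ∫ x, f x := by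
  rw [Measure.integral_comp_smul, finrank_euclideanSpace_fin, abs_of_pos (by positivity),
    smul_eq_mul]

lemma integral_norm_gradient_sq_comp_smul {d : ℕ} {t : ℝ} (ht : 0 < t)
    (v : EuclideanSpace ℝ (Fin d) → ℝ) :
    ∫ x, ‖gradient (fun y => v (t • y)) x‖ ^ 2 =
      (t ^ d)⁻¹ * (t ^ 2 * ∫ x, ‖gradient v x‖ ^ 2) := by
  simp_rw [norm_gradient_comp_smul, mul_pow, sq_abs]
  rw [integral_const_mul, integral_comp_smul_of_pos ht (fun x => ‖gradient v x‖ ^ 2)]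
  ring

lemma LipschitzWith.exists_comp_smul {d : ℕ} {v : EuclideanSpace ℝ (Fin d) → ℝ}
    (hv : ∃ K, LipschitzWith K v) (t : ℝ) : ∃ K, LipschitzWith K fun y => v (t • y) := by
  obtain ⟨K, hK⟩ := hv
  exact ⟨_, hK.comp (lipschitzWith_smul t)⟩

lemma LipschitzWith.exists_const_mul {d : ℕ} {v : EuclideanSpace ℝ (Fin d) → ℝ}
    (hv : ∃ K, LipschitzWith K v) (t : ℝ) : ∃ K, LipschitzWith K fun y => t * v y := by
  obtain ⟨K, hK⟩ := hv
  exact ⟨_, (lipschitzWith_smul t).comp hK⟩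

lemma rayleigh_nonneg {d : ℕ} (u : EuclideanSpace ℝ (Fin d) → ℝ) : 0 ≤ rayleigh d u :=
  div_nonneg (integral_nonneg fun _ => by positivity) (integral_nonneg fun _ => by positivity)

lemma dirichletEV_le_rayleigh {d : ℕ} {Ω : Set (EuclideanSpace ℝ (Fin d))}
    {u : EuclideanSpace ℝ (Fin d) → ℝ} (hu : IsDirTrial d Ω u) :
    dirichletEV d Ω ≤ rayleigh d u :=
  csInf_le ⟨0, by rintro _ ⟨w, -, rfl⟩; exact rayleigh_nonneg w⟩ ⟨u, hu, rfl⟩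

lemma twistedEV_le_rayleigh {d : ℕ} {Ω : Set (EuclideanSpace ℝ (Fin d))}
    {g u : EuclideanSpace ℝ (Fin d) → ℝ} (hu : IsDirTrial d Ω u) (hg : ∫ x, u x * g x = 0) :
    twistedEV d Ω g ≤ rayleigh d u :=
  csInf_le ⟨0, by rintro _ ⟨w, -, -, rfl⟩; exact rayleigh_nonneg w⟩ ⟨u, hu, hg, rfl⟩

lemma twistedEV_nonneg {d : ℕ} (Ω : Set (EuclideanSpace ℝ (Fin d)))
    (g : EuclideanSpace ℝ (Fin d) → ℝ) : 0 ≤ twistedEV d Ω g :=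
  Real.sInf_nonneg (by rintro _ ⟨w, -, -, rfl⟩; exact rayleigh_nonneg w)

lemma not_ae_zero_of_integral_sq_pos {d : ℕ} {u : EuclideanSpace ℝ (Fin d) → ℝ}
    (h : 0 < ∫ x, u x ^ 2) : ¬ (u =ᵐ[volume] fun _ => (0 : ℝ)) := by
  intro h0
  have : ∫ x, u x ^ 2 = ∫ _ : EuclideanSpace ℝ (Fin d), (0 : ℝ) :=
    integral_congr_ae (h0.mono fun x hx => by simp [hx])
  simp [this] at h

lemma dirichletEV_ball_mul_integral_sq_le {d : ℕ} {v : EuclideanSpace ℝ (Fin d) → ℝ}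
    (hv : ∃ K, LipschitzWith K v) {r : ℝ} (hr : 0 < r) (h0 : ∀ x, r ≤ ‖x‖ → v x = 0) :
    dirichletEV d (ball 0 1) * ∫ x, v x ^ 2 ≤ r ^ 2 * ∫ x, ‖gradient v x‖ ^ 2 := by
  have hA : 0 ≤ ∫ x, ‖gradient v x‖ ^ 2 := integral_nonneg fun _ => by positivity
  rcases (integral_nonneg fun x => sq_nonneg (v x) : 0 ≤ ∫ x, v x ^ 2).eq_or_lt with hN | hN
  · rw [← hN, mul_zero]
    positivity
  · have hNs := integral_comp_smul_of_pos hr fun x => v x ^ 2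
    have htr : IsDirTrial d (ball 0 1) fun x => v (r • x) := by
      refine ⟨LipschitzWith.exists_comp_smul hv r, fun x hx => h0 _ ?_,
        not_ae_zero_of_integral_sq_pos ?_⟩
      · rw [mem_ball_zero_iff, not_lt] at hx
        rw [norm_smul, Real.norm_of_nonneg hr.le]
        nlinarith
      · rw [hNs]
        positivity
    have h := dirichletEV_le_rayleigh htr
    rw [rayleigh, hNs, integral_norm_gradient_sq_comp_smul hr,
      mul_div_mul_left _ _ (by positivity), le_div_iff₀ hN] at h
    exact h

lemma dirichletEV_ball_mul_integral_sq_le_of_volume_le {d : ℕ} (hd : 0 < d)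
    {v : EuclideanSpace ℝ (Fin d) → ℝ} (hv : ∃ K, LipschitzWith K v) (hv0 : ∀ x, 0 ≤ v x)
    {R : ℝ} (hR : ∀ x, R < ‖x‖ → v x = 0) {r : ℝ} (hr : 0 < r)
    (hvol : volume {x | 0 < v x} ≤ volume (ball (0 : EuclideanSpace ℝ (Fin d)) r)) :
    dirichletEV d (ball 0 1) * ∫ x, v x ^ 2 ≤ r ^ 2 * ∫ x, ‖gradient v x‖ ^ 2 := by
  obtain ⟨K, hK⟩ := hv
  obtain ⟨w, hw, -, hwr, -, hN, hA⟩ := exists_schwarz_symmetrization hd hK hv0 hR hr hvol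
  have := dirichletEV_ball_mul_integral_sq_le ⟨K, hw⟩ hr hwr
  rw [hN] at this
  exact this.trans (by gcongr)

lemma volume_ball_eq_ofReal {d : ℕ} (c : EuclideanSpace ℝ (Fin d)) {r : ℝ} (hr : 0 < r) :
    volume (ball c r) =
      ENNReal.ofReal ((volume (ball (0 : EuclideanSpace ℝ (Fin d)) 1)).toReal * r ^ d) := by
  rw [mul_comm, ENNReal.ofReal_mul (by positivity), ENNReal.ofReal_toReal measure_ball_lt_top.ne,
    Measure.addHaar_ball_of_pos _ _ hr, finrank_euclideanSpace_fin]

lemma volume_unitBall_toReal_pos {d : ℕ} :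
    0 < (volume (ball (0 : EuclideanSpace ℝ (Fin d)) 1)).toReal :=
  ENNReal.toReal_pos (measure_ball_pos _ _ one_pos).ne' measure_ball_lt_top.ne

/-- A pair of nonnegative profiles supported in centred balls of radii `rp` and `rm`, balanced for
the weights `α` and `1`, with joint Rayleigh quotient at most `μ`. -/
structure IsBallPair (d : ℕ) (α rp rm μ : ℝ) (a b : EuclideanSpace ℝ (Fin d) → ℝ) : Prop where
  lip_left : ∃ K, LipschitzWith K a
  lip_right : ∃ K, LipschitzWith K b
  nonneg_left : ∀ x, 0 ≤ a x
  nonneg_right : ∀ x, 0 ≤ b x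
  vanish_left : ∀ x, rp ≤ ‖x‖ → a x = 0
  vanish_right : ∀ x, rm ≤ ‖x‖ → b x = 0
  balance : α * ∫ x, a x = ∫ x, b x
  mass : (∫ x, a x ^ 2) + ∫ x, b x ^ 2 = 1
  energy : (∫ x, ‖gradient a x‖ ^ 2) + ∫ x, ‖gradient b x‖ ^ 2 ≤ μ

lemma exists_isBallPair_of_scale {d : ℕ} {α rp rm μ : ℝ} {a b : EuclideanSpace ℝ (Fin d) → ℝ}
    (ha : ∃ K, LipschitzWith K a) (hb : ∃ K, LipschitzWith K b)
    (ha0 : ∀ x, 0 ≤ a x) (hb0 : ∀ x, 0 ≤ b x)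
    (hav : ∀ x, rp ≤ ‖x‖ → a x = 0) (hbv : ∀ x, rm ≤ ‖x‖ → b x = 0)
    (hbal : α * ∫ x, a x = ∫ x, b x) (hN : 0 < (∫ x, a x ^ 2) + ∫ x, b x ^ 2)
    (hA : (∫ x, ‖gradient a x‖ ^ 2) + ∫ x, ‖gradient b x‖ ^ 2 ≤
      μ * ((∫ x, a x ^ 2) + ∫ x, b x ^ 2)) : ∃ a b, IsBallPair d α rp rm μ a b := by
  set N := (∫ x, a x ^ 2) + ∫ x, b x ^ 2 with hNdef
  set t := (√N)⁻¹ with ht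
  have ht2 : t ^ 2 = N⁻¹ := by rw [ht, inv_pow, Real.sq_sqrt hN.le]
  have ht0 : 0 ≤ t := by positivity
  refine ⟨fun x => t * a x, fun x => t * b x, LipschitzWith.exists_const_mul ha t,
    LipschitzWith.exists_const_mul hb t, fun x => mul_nonneg ht0 (ha0 x),
    fun x => mul_nonneg ht0 (hb0 x), fun x hx => by simp [hav x hx], fun x hx => by simp [hbv x hx],
    ?_, ?_, ?_⟩
  · rw [integral_const_mul, integral_const_mul, ← hbal]
    ring
  · simp_rw [mul_pow]
    rw [integral_const_mul, integral_const_mul, ← mul_add, ← hNdef, ht2, inv_mul_cancel₀ hN.ne']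
  · simp_rw [norm_gradient_const_mul, mul_pow, sq_abs]
    rw [integral_const_mul, integral_const_mul, ← mul_add, ht2, inv_mul_le_iff₀ hN]
    linarith

lemma IsBallPair.exists_scale {d : ℕ} {α rp rm μ : ℝ} {a b : EuclideanSpace ℝ (Fin d) → ℝ}
    (h : IsBallPair d α rp rm μ a b) {t rp' rm' : ℝ} (ht : 0 < t) (hp : rp ≤ t * rp')
    (hm : rm ≤ t * rm') : ∃ a b, IsBallPair d α rp' rm' (t ^ 2 * μ) a b := by
  have hnorm : ∀ {r s : ℝ} (_ : r ≤ t * s) (x : EuclideanSpace ℝ (Fin d)) (_ : s ≤ ‖x‖),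
      r ≤ ‖t • x‖ := fun hrs x hx => by
    rw [norm_smul, Real.norm_of_nonneg ht.le]
    exact hrs.trans (by gcongr)
  have hta := integral_comp_smul_of_pos ht a
  have htb := integral_comp_smul_of_pos ht b
  have hta2 := integral_comp_smul_of_pos ht fun x => a x ^ 2
  have htb2 := integral_comp_smul_of_pos ht fun x => b x ^ 2
  refine exists_isBallPair_of_scale (LipschitzWith.exists_comp_smul h.lip_left t)
    (LipschitzWith.exists_comp_smul h.lip_right t) (fun x => h.nonneg_left _)
    (fun x => h.nonneg_right _) (fun x hx => h.vanish_left _ (hnorm hp x hx))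
    (fun x hx => h.vanish_right _ (hnorm hm x hx)) ?_ ?_ ?_
  · rw [hta, htb, ← h.balance]
    ring
  · rw [hta2, htb2, ← mul_add, h.mass]
    positivity
  · rw [hta2, htb2, ← mul_add, h.mass, integral_norm_gradient_sq_comp_smul ht,
      integral_norm_gradient_sq_comp_smul ht, ← mul_add, ← mul_add, mul_one, mul_comm (t ^ 2 * μ)]
    have := h.energy
    gcongr

lemma integrable_of_lipschitzWith {d : ℕ} {v : EuclideanSpace ℝ (Fin d) → ℝ}
    (hv : ∃ K, LipschitzWith K v) {R : ℝ} (hR : ∀ x, R < ‖x‖ → v x = 0) :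
    Integrable v ∧ Integrable (fun x => v x ^ 2) ∧ Integrable fun x => ‖gradient v x‖ ^ 2 := by
  obtain ⟨K, hK⟩ := hv
  exact ⟨integrable_of_continuous_of_vanish hK.continuous hR,
    integrable_of_continuous_of_vanish (R := R) (hK.continuous.pow 2) fun x hx => by simp [hR x hx],
    integrable_norm_gradient_sq hK hR⟩

lemma IsBallPair.twistedEV_le {d : ℕ} {α rp rm μ : ℝ} {a b : EuclideanSpace ℝ (Fin d) → ℝ}
    (h : IsBallPair d α rp rm μ a b) {c : EuclideanSpace ℝ (Fin d)} (hc : rp + rm < ‖c‖) :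
    twistedEV d (ball 0 rp ∪ ball c rm) (chiBang d α (ball c rm)) ≤ μ := by
  have hbc : ∀ x, x ∉ ball c rm → b (x - c) = 0 := fun x hx => h.vanish_right _ (by
    simpa [dist_eq_norm] using hx)
  have haz : ∀ x, x ∉ ball 0 rp → a x = 0 := fun x hx => h.vanish_left _ (by simpa using hx)
  have hsep : ∀ x, rp < ‖x‖ ∨ rm < ‖x - c‖ := by
    intro x
    by_contra! hx
    have : ‖c‖ ≤ ‖x‖ + ‖x - c‖ := by
      simpa using norm_sub_le x (x - c)
    linarith
  have hloc : ∀ x, a =ᶠ[nhds x] (fun _ => 0) ∨ (fun y => b (y - c)) =ᶠ[nhds x] fun _ => 0 := by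
    intro x
    rcases hsep x with hx | hx
    · left
      have hcont : Continuous fun y : EuclideanSpace ℝ (Fin d) => ‖y‖ := by fun_prop
      exact (hcont.continuousAt.eventually_const_lt hx).mono fun y hy => h.vanish_left y hy.le
    · right
      have hcont : Continuous fun y : EuclideanSpace ℝ (Fin d) => ‖y - c‖ := by fun_prop
      exact (hcont.continuousAt.eventually_const_lt hx).mono fun y hy => h.vanish_right _ hy.le
  have hlb : ∃ K, LipschitzWith K fun y => b (y - c) := by
    obtain ⟨K, hK⟩ := h.lip_right
    exact ⟨K, LipschitzWith.of_dist_le_mul fun x y => by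
      simpa using hK.dist_le_mul (x - c) (y - c)⟩
  obtain ⟨ha1, ha2, ha3⟩ := integrable_of_lipschitzWith h.lip_left
    fun x (hx : rp < ‖x‖) => h.vanish_left x hx.le
  obtain ⟨hb1, hb2, hb3⟩ := integrable_of_lipschitzWith (R := rm + ‖c‖) hlb fun x hx =>
    h.vanish_right _ (by linarith [norm_le_norm_add_norm_sub' x c, norm_sub_rev c x])
  let w : EuclideanSpace ℝ (Fin d) → ℝ := fun x => a x - b (x - c)
  have hN : ∫ x, w x ^ 2 = 1 := by
    have hpt : ∀ x, w x ^ 2 = a x ^ 2 + b (x - c) ^ 2 := by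
      intro x
      rcases hloc x with hx | hx
      · simp [w, hx.self_of_nhds]
      · have := hx.self_of_nhds
        simp only at this
        simp [w, this]
    simp_rw [hpt]
    rw [integral_add ha2 hb2, integral_sub_right_eq_self fun x => b x ^ 2, h.mass]
  have hA : ∫ x, ‖gradient w x‖ ^ 2 ≤ μ := by
    have hpt : ∀ x, ‖gradient w x‖ ^ 2 =
        ‖gradient a x‖ ^ 2 + ‖gradient (fun y => b (y - c)) x‖ ^ 2 :=
      fun x => norm_gradient_sub_sq (hloc x)
    simp_rw [hpt]
    rw [integral_add ha3 hb3]
    simp_rw [norm_gradient_comp_sub]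
    rw [integral_sub_right_eq_self fun x => ‖gradient b x‖ ^ 2]
    exact h.energy
  have hw : IsDirTrial d (ball 0 rp ∪ ball c rm) w := by
    refine ⟨?_, fun x hx => ?_, not_ae_zero_of_integral_sq_pos (by rw [hN]; exact one_pos)⟩
    · obtain ⟨K, hK⟩ := h.lip_left
      obtain ⟨K', hK'⟩ := hlb
      exact ⟨_, hK.sub hK'⟩
    · rw [mem_union, not_or] at hx
      simp [w, haz x hx.1, hbc x hx.2]
  have horth : ∫ x, w x * chiBang d α (ball c rm) x = 0 := by
    have hpt : ∀ x, w x * chiBang d α (ball c rm) x = α * a x - b (x - c) := by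
      intro x
      by_cases hx : x ∈ ball c rm
      · have : a x = 0 := h.vanish_left x <| by
          rcases hsep x with h1 | h1
          · exact h1.le
          · rw [mem_ball, dist_eq_norm] at hx
            exact absurd hx h1.not_gt
        rw [chiBang, if_pos hx]
        simp [w, this]
      · rw [chiBang, if_neg hx]
        simp [w, hbc x hx, mul_comm]
    simp_rw [hpt]
    rw [integral_sub (ha1.const_mul α) hb1, integral_const_mul, h.balance,
      integral_sub_right_eq_self b, sub_self]
  refine (twistedEV_le_rayleigh hw horth).trans ?_
  rw [rayleigh, hN, div_one]
  exact hA

lemma sq_integral_le_of_vanish {d : ℕ} {v : EuclideanSpace ℝ (Fin d) → ℝ}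
    (hv : ∃ K, LipschitzWith K v) {r : ℝ} (hr : 0 < r) (h0 : ∀ x, r ≤ ‖x‖ → v x = 0) :
    (∫ x, v x) ^ 2 ≤
      (volume (ball (0 : EuclideanSpace ℝ (Fin d)) 1)).toReal * r ^ d * ∫ x, v x ^ 2 := by
  obtain ⟨h1, h2, -⟩ := integrable_of_lipschitzWith hv fun x (hx : r < ‖x‖) => h0 x hx.le
  have hS0 : ∀ x ∉ ball (0 : EuclideanSpace ℝ (Fin d)) r, v x = 0 :=
    fun x hx => h0 x (by simpa using hx)
  set W := (volume (ball (0 : EuclideanSpace ℝ (Fin d)) 1)).toReal * r ^ d with hW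
  have hWpos : 0 < W := by
    have := volume_unitBall_toReal_pos (d := d)
    positivity
  have hvol : volume.real (ball (0 : EuclideanSpace ℝ (Fin d)) r) = W := by
    rw [measureReal_def, volume_ball_eq_ofReal _ hr, ENNReal.toReal_ofReal hWpos.le]
  set m := (∫ x, v x) / W with hm
  have hconst : ∀ c : ℝ, IntegrableOn (fun _ => c) (ball (0 : EuclideanSpace ℝ (Fin d)) r) :=
    fun c => integrableOn_const measure_ball_lt_top.ne
  have hexp : ∫ x in ball (0 : EuclideanSpace ℝ (Fin d)) r, (v x - m) ^ 2 =
      (∫ x, v x ^ 2) - 2 * m * (∫ x, v x) + m ^ 2 * W := by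
    have hpt : ∀ x, (v x - m) ^ 2 = v x ^ 2 - 2 * m * v x + m ^ 2 := fun x => by ring
    have hi : IntegrableOn (fun x => v x ^ 2 - 2 * m * v x)
        (ball (0 : EuclideanSpace ℝ (Fin d)) r) :=
      h2.integrableOn.sub (h1.integrableOn.const_mul _)
    simp_rw [hpt]
    rw [integral_add hi (hconst _), integral_sub h2.integrableOn (h1.integrableOn.const_mul _), integral_const_mul,
      setIntegral_eq_integral_of_forall_compl_eq_zero hS0,
      setIntegral_eq_integral_of_forall_compl_eq_zero fun x hx => by simp [hS0 x hx],
      setIntegral_const, hvol, smul_eq_mul, mul_comm W]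
  have hnn : 0 ≤ ∫ x in ball (0 : EuclideanSpace ℝ (Fin d)) r, (v x - m) ^ 2 :=
    integral_nonneg fun x => by positivity
  have hmW : m * W = ∫ x, v x := div_mul_cancel₀ _ hWpos.ne'
  rw [hexp] at hnn
  nlinarith

/-- An upper bound for the mass of a normalised balanced pair whose smaller radius is `r`. -/
def pairMassBound (d : ℕ) (α V L M r : ℝ) : ℝ :=
  r ^ 2 * M / L + 2 * (((√(V * r ^ d * (r ^ 2 * M / L)) / α / V) ^ (1 / (d : ℝ))) ^ 2 * M / L) +
    2 * (√(V * r ^ d * (r ^ 2 * M / L)) / α)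

lemma continuous_pairMassBound {d : ℕ} (α V L M : ℝ) :
    Continuous (pairMassBound d α V L M) := by
  unfold pairMassBound
  have : Continuous fun x : ℝ => x ^ (1 / (d : ℝ)) := Real.continuous_rpow_const (by positivity)
  fun_prop

lemma pairMassBound_zero {d : ℕ} (hd : 0 < d) (α V L M : ℝ) : pairMassBound d α V L M 0 = 0 := by
  have : (d : ℝ)⁻¹ ≠ 0 := by positivity
  simp [pairMassBound, Real.zero_rpow this]

lemma IsBallPair.one_le_pairMassBound {d : ℕ} (hd : 0 < d) {α rp rm M : ℝ} (hα : 0 < α)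
    {a b : EuclideanSpace ℝ (Fin d) → ℝ} (h : IsBallPair d α rp rm M a b) (hrm : 0 < rm)
    (hM : 0 < M) (hL : 0 < dirichletEV d (ball 0 1)) :
    1 ≤ pairMassBound d α (volume (ball (0 : EuclideanSpace ℝ (Fin d)) 1)).toReal
      (dirichletEV d (ball 0 1)) M rm := by
  set V := (volume (ball (0 : EuclideanSpace ℝ (Fin d)) 1)).toReal with hVdef
  set L := dirichletEV d (ball (0 : EuclideanSpace ℝ (Fin d)) 1) with hLdef
  have hV : 0 < V := volume_unitBall_toReal_pos
  have hAa : 0 ≤ ∫ x, ‖gradient a x‖ ^ 2 := integral_nonneg fun _ => by positivity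
  have hAb : 0 ≤ ∫ x, ‖gradient b x‖ ^ 2 := integral_nonneg fun _ => by positivity
  have hE := h.energy
  obtain ⟨ha1, ha2, ha3⟩ := integrable_of_lipschitzWith h.lip_left
    fun x (hx : rp < ‖x‖) => h.vanish_left x hx.le
  have hNb : ∫ x, b x ^ 2 ≤ rm ^ 2 * M / L := by
    rw [le_div_iff₀ hL, mul_comm]
    refine (dirichletEV_ball_mul_integral_sq_le h.lip_right hrm h.vanish_right).trans ?_
    gcongr
    linarith
  set I := √(V * rm ^ d * (rm ^ 2 * M / L)) / α with hI
  have hIpos : 0 < I := by positivity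
  have hIa : ∫ x, a x ≤ I := by
    rw [hI, le_div_iff₀ hα, mul_comm, h.balance]
    refine Real.le_sqrt_of_sq_le ((sq_integral_le_of_vanish h.lip_right hrm h.vanish_right).trans ?_)
    gcongr
  set ρ := (I / V) ^ (1 / (d : ℝ)) with hρ
  have hρpos : 0 < ρ := by positivity
  have hρd : V * ρ ^ d = I := by
    rw [hρ, one_div, Real.rpow_inv_natCast_pow (by positivity) hd.ne', mul_div_cancel₀ _ hV.ne']
  have hlip : ∃ K, LipschitzWith K fun x => max (a x - 1) 0 := by
    obtain ⟨K, hK⟩ := h.lip_left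
    exact ⟨_, (hK.sub (LipschitzWith.const 1)).max_const 0⟩
  have hvan : ∀ x : EuclideanSpace ℝ (Fin d), rp < ‖x‖ → max (a x - 1) 0 = 0 := fun x hx => by
    simp [h.vanish_left x hx.le]
  have hset : volume {x | 0 < max (a x - 1) 0} ≤
      volume (ball (0 : EuclideanSpace ℝ (Fin d)) ρ) := by
    have hsub : {x | 0 < max (a x - 1) 0} ⊆ {x | 1 ≤ a x} := by
      intro x hx
      have hx : 0 < max (a x - 1) 0 := hx
      simp only [lt_max_iff, lt_irrefl, or_false, sub_pos] at hx
      exact hx.le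
    refine (measure_mono hsub).trans ?_
    rw [volume_ball_eq_ofReal _ hρpos, ← hVdef, hρd]
    have hfin : volume {x | 1 ≤ a x} ≠ ⊤ := by
      refine ((measure_mono fun x (hx : 1 ≤ a x) => ?_).trans_lt
        (measure_closedBall_lt_top (x := (0 : EuclideanSpace ℝ (Fin d))) (r := rp))).ne
      rw [mem_closedBall_zero_iff]
      by_contra! hc
      rw [h.vanish_left x hc.le] at hx
      linarith
    rw [← ENNReal.ofReal_toReal hfin]
    refine ENNReal.ofReal_le_ofReal (le_trans ?_ hIa)
    simpa [measureReal_def] using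
      mul_meas_ge_le_integral_of_nonneg (Eventually.of_forall h.nonneg_left) ha1 1
  have hN1 : ∫ x, (max (a x - 1) 0) ^ 2 ≤ ρ ^ 2 * M / L := by
    rw [le_div_iff₀ hL, mul_comm]
    refine (dirichletEV_ball_mul_integral_sq_le_of_volume_le hd hlip
      (fun x => le_max_right _ _) hvan hρpos hset).trans ?_
    gcongr
    refine (integral_mono (integrable_of_lipschitzWith hlip hvan).2.2 ha3 fun x =>
      norm_gradient_sub_max_zero_le ?_ 1 x).trans (by linarith)
    obtain ⟨K, hK⟩ := h.lip_left
    exact hK.continuous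
  have hNa : ∫ x, a x ^ 2 ≤ 2 * (ρ ^ 2 * M / L) + 2 * I := by
    have hi := (integrable_of_lipschitzWith hlip hvan).2.1
    calc ∫ x, a x ^ 2 ≤ ∫ x, (2 * (max (a x - 1) 0) ^ 2 + 2 * a x) := by
          refine integral_mono ha2 ((hi.const_mul 2).add (ha1.const_mul 2)) fun x => ?_
          have := h.nonneg_left x
          rcases le_total (a x) 1 with hx | hx
          · simp only [max_eq_right (sub_nonpos.2 hx)]
            nlinarith
          · simp only [max_eq_left (sub_nonneg.2 hx)]
            nlinarith [sq_nonneg (a x - 1)]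
      _ = 2 * (∫ x, (max (a x - 1) 0) ^ 2) + 2 * ∫ x, a x := by
          rw [integral_add (hi.const_mul 2) (ha1.const_mul 2), integral_const_mul,
            integral_const_mul]
      _ ≤ _ := by gcongr
  have hm := h.mass
  unfold pairMassBound
  rw [← hI, ← hρ]
  linarith

lemma integral_pos_of_volume_pos {d : ℕ} {v : EuclideanSpace ℝ (Fin d) → ℝ}
    (hv0 : ∀ x, 0 ≤ v x) (hi : Integrable v) (hpos : 0 < volume {x | 0 < v x}) :
    0 < ∫ x, v x := by
  rw [integral_pos_iff_support_of_nonneg hv0 hi]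
  exact hpos.trans_le (measure_mono fun x (hx : 0 < v x) => hx.ne')

lemma integrable_mul_weight {d : ℕ} {α : ℝ} (hα : 0 < α)
    {v g : EuclideanSpace ℝ (Fin d) → ℝ} (hv : Integrable v) (hgm : Measurable g)
    (hg : ∀ᵐ x, α ≤ g x ∧ g x ≤ 1) : Integrable fun x => v x * g x :=
  hv.mul_bdd (c := 1) hgm.aestronglyMeasurable <| hg.mono fun x hx => by
    rw [Real.norm_of_nonneg (hα.le.trans hx.1)]
    exact hx.2

lemma exists_radius {d : ℕ} (hd : 0 < d) {p : ℝ} (hp : 0 < p) : ∃ r, 0 < r ∧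
    (volume (ball (0 : EuclideanSpace ℝ (Fin d)) 1)).toReal * r ^ d = p := by
  have hV := volume_unitBall_toReal_pos (d := d)
  refine ⟨(p / (volume (ball (0 : EuclideanSpace ℝ (Fin d)) 1)).toReal) ^ (1 / (d : ℝ)),
    by positivity, ?_⟩
  rw [one_div, Real.rpow_inv_natCast_pow (by positivity) hd.ne', mul_div_cancel₀ _ hV.ne']

lemma sq_mul_lt_of_volume_lt {d : ℕ} (hd : 0 < d) {V r W μ L : ℝ} (hV : 0 < V) (hr : 0 < r)
    (hμ : 0 ≤ μ) (hW : 2 * (V * r ^ d) ≤ W)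
    (h : W ^ ((2 : ℝ) / d) * μ < (2 : ℝ) ^ ((2 : ℝ) / d) * (V ^ ((2 : ℝ) / d) * L)) :
    r ^ 2 * μ < L := by
  have hd' : (d : ℝ) ≠ 0 := by positivity
  have h1 : (2 * (V * r ^ d)) ^ ((2 : ℝ) / d) =
      (2 : ℝ) ^ ((2 : ℝ) / d) * (V ^ ((2 : ℝ) / d) * r ^ 2) := by
    rw [Real.mul_rpow two_pos.le (by positivity), Real.mul_rpow hV.le (by positivity),
      ← Real.rpow_natCast r d, ← Real.rpow_mul hr.le, mul_div_cancel₀ _ hd', Real.rpow_two]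
  have h2 : (2 * (V * r ^ d)) ^ ((2 : ℝ) / d) ≤ W ^ ((2 : ℝ) / d) :=
    Real.rpow_le_rpow (by positivity) hW (by positivity)
  have h3 := (mul_le_mul_of_nonneg_right h2 hμ).trans_lt h
  rw [h1, mul_assoc, mul_assoc] at h3
  exact lt_of_mul_lt_mul_left (lt_of_mul_lt_mul_left h3 (by positivity)) (by positivity)

lemma volume_neg_set_pos {d : ℕ} {α : ℝ} (hα : 0 < α) {g u : EuclideanSpace ℝ (Fin d) → ℝ}
    (hgm : Measurable g) (hg : ∀ᵐ x, α ≤ g x ∧ g x ≤ 1) (hu : Integrable u)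
    (hne : ¬ (u =ᵐ[volume] fun _ => (0 : ℝ))) (horth : ∫ x, u x * g x = 0) :
    0 < volume {x | u x < 0} := by
  rw [pos_iff_ne_zero]
  intro h0
  have hnn : ∀ᵐ x, 0 ≤ u x := by
    rw [ae_iff]
    simpa using h0
  have h1 : 0 ≤ᵐ[volume] fun x => u x * g x := by
    filter_upwards [hnn, hg] with x hx hgx
    exact mul_nonneg hx (hα.le.trans hgx.1)
  rw [integral_eq_zero_iff_of_nonneg_ae h1 (integrable_mul_weight hα hu hgm hg)] at horth
  refine hne ?_
  filter_upwards [horth, hg] with x hx hgx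
  exact (mul_eq_zero.1 hx).resolve_right (hα.trans_le hgx.1).ne'

lemma exists_isBallPair_of_trial {d : ℕ} (hd : 0 < d) {α : ℝ} (hα0 : 0 < α)
    {Ω : Set (EuclideanSpace ℝ (Fin d))} (hΩb : Bornology.IsBounded Ω)
    {g u : EuclideanSpace ℝ (Fin d) → ℝ} (hgm : Measurable g)
    (hg : ∀ᵐ x, α ≤ g x ∧ g x ≤ 1) (hu : IsDirTrial d Ω u) (horth : ∫ x, u x * g x = 0)
    (hsmall : (volume Ω).toReal ^ ((2 : ℝ) / d) * rayleigh d u <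
      (2 : ℝ) ^ ((2 : ℝ) / d) *
        ((volume (ball (0 : EuclideanSpace ℝ (Fin d)) 1)).toReal ^ ((2 : ℝ) / d) *
          dirichletEV d (ball (0 : EuclideanSpace ℝ (Fin d)) 1)))
    (hle : volume {x | u x < 0} ≤ volume {x | 0 < u x}) :
    ∃ rp rm, 0 < rm ∧ rm ≤ rp ∧
      (volume (ball (0 : EuclideanSpace ℝ (Fin d)) 1)).toReal * rp ^ d +
        (volume (ball (0 : EuclideanSpace ℝ (Fin d)) 1)).toReal * rm ^ d ≤ (volume Ω).toReal ∧
      ∃ a b, IsBallPair d α rp rm (rayleigh d u) a b := by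
  obtain ⟨⟨K, hK⟩, hΩ0, hne⟩ := hu
  have huc := hK.continuous
  obtain ⟨R, hR⟩ := hΩb.subset_closedBall (0 : EuclideanSpace ℝ (Fin d))
  have huR : ∀ x, R < ‖x‖ → u x = 0 := fun x hx => hΩ0 x fun h => by
    have := mem_closedBall_zero_iff.1 (hR h)
    linarith
  obtain ⟨hu1, hu2, hu3⟩ := integrable_of_lipschitzWith ⟨K, hK⟩ huR
  have hΩlt : volume Ω < ⊤ := hΩb.measure_lt_top
  have hsubp : {x | 0 < u x} ⊆ Ω := fun x (hx : 0 < u x) => by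
    by_contra h
    exact hx.ne' (hΩ0 x h)
  have hsubm : {x | u x < 0} ⊆ Ω := fun x (hx : u x < 0) => by
    by_contra h
    exact hx.ne (hΩ0 x h)
  have hpfin := ((measure_mono hsubp).trans_lt hΩlt).ne
  have hmfin := ((measure_mono hsubm).trans_lt hΩlt).ne
  have hmpos := volume_neg_set_pos hα0 hgm hg hu1 hne horth
  have hppos := hmpos.trans_le hle
  obtain ⟨rp, hrp, hrpV⟩ := exists_radius hd (ENNReal.toReal_pos hppos.ne' hpfin)
  obtain ⟨rm, hrm, hrmV⟩ := exists_radius hd (ENNReal.toReal_pos hmpos.ne' hmfin)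
  have hV := volume_unitBall_toReal_pos (d := d)
  have hlereal := ENNReal.toReal_mono hpfin hle
  have hrr : rm ≤ rp := by
    rw [← hrpV, ← hrmV] at hlereal
    exact le_of_pow_le_pow_left₀ hd.ne' hrp.le (le_of_mul_le_mul_left hlereal hV)
  have hsum : (volume {x | 0 < u x}).toReal + (volume {x | u x < 0}).toReal ≤
      (volume Ω).toReal := by
    rw [← ENNReal.toReal_add hpfin hmfin, ← measure_union _ (measurableSet_lt huc.measurable
      measurable_const)]
    · exact ENNReal.toReal_mono hΩlt.ne (measure_mono (union_subset hsubp hsubm))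
    · exact disjoint_left.2 fun x (h1 : 0 < u x) (h2 : u x < 0) => h1.not_gt h2
  refine ⟨rp, rm, hrm, hrr, by rw [hrpV, hrmV]; exact hsum, ?_⟩
  set μ := rayleigh d u with hμ
  have hμ0 : 0 ≤ μ := rayleigh_nonneg u
  have hPl : LipschitzWith K fun x => max (u x) 0 := hK.max_const 0
  have hMl : LipschitzWith K fun x => max (-u x) 0 := hK.neg.max_const 0
  have hPR : ∀ x, R < ‖x‖ → max (u x) 0 = 0 := fun x hx => by simp [huR x hx]
  have hMR : ∀ x, R < ‖x‖ → max (-u x) 0 = 0 := fun x hx => by simp [huR x hx]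
  obtain ⟨hP1, hP2, hP3⟩ := integrable_of_lipschitzWith ⟨K, hPl⟩ hPR
  obtain ⟨hM1, hM2, hM3⟩ := integrable_of_lipschitzWith ⟨K, hMl⟩ hMR
  have hPset : {x | 0 < max (u x) 0} = {x | 0 < u x} := by
    ext x
    simp
  have hMset : {x | 0 < max (-u x) 0} = {x | u x < 0} := by
    ext x
    simp
  have hMpos : 0 < ∫ x, max (-u x) 0 :=
    integral_pos_of_volume_pos (fun x => le_max_right _ _) hM1 (by rwa [hMset])
  have hP2pos : 0 < ∫ x, (max (u x) 0) ^ 2 :=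
    integral_pos_of_volume_pos (fun x => sq_nonneg _) hP2 (hppos.trans_le (measure_mono
      fun x (hx : 0 < u x) => show 0 < (max (u x) 0) ^ 2 by positivity))
  have hN : ∫ x, u x ^ 2 = (∫ x, (max (u x) 0) ^ 2) + ∫ x, (max (-u x) 0) ^ 2 := by
    rw [← integral_add hP2 hM2]
    refine integral_congr_ae (Eventually.of_forall fun x => ?_)
    rcases le_total (u x) 0 with hx | hx <;> simp [hx]
  have hA : (∫ x, ‖gradient (fun y => max (u y) 0) x‖ ^ 2) +
      ∫ x, ‖gradient (fun y => max (-u y) 0) x‖ ^ 2 ≤ ∫ x, ‖gradient u x‖ ^ 2 := by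
    rw [← integral_add hP3 hM3]
    exact integral_mono (hP3.add hM3) hu3 fun x => norm_gradient_posPart_add_negPart_le huc x
  have hNpos : 0 < ∫ x, u x ^ 2 := by
    have : 0 ≤ ∫ x, (max (-u x) 0) ^ 2 := integral_nonneg fun _ => by positivity
    linarith
  have hAN : ∫ x, ‖gradient u x‖ ^ 2 = μ * ∫ x, u x ^ 2 := by
    rw [hμ, rayleigh, div_mul_cancel₀ _ hNpos.ne']
  have hbal : α * ∫ x, max (u x) 0 ≤ ∫ x, max (-u x) 0 := by
    have hPg := integrable_mul_weight hα0 hP1 hgm hg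
    have hMg := integrable_mul_weight hα0 hM1 hgm hg
    have heq : ∫ x, max (u x) 0 * g x = ∫ x, max (-u x) 0 * g x := by
      rw [← sub_eq_zero, ← integral_sub hPg hMg]
      refine (integral_congr_ae (Eventually.of_forall fun x => ?_)).trans horth
      rcases le_total (u x) 0 with hx | hx <;> simp [hx]
    calc α * ∫ x, max (u x) 0 = ∫ x, α * max (u x) 0 := (integral_const_mul _ _).symm
      _ ≤ ∫ x, max (u x) 0 * g x := by
          refine integral_mono_ae (hP1.const_mul α) hPg (hg.mono fun x hx => ?_)
          have : 0 ≤ max (u x) 0 := le_max_right _ _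
          simp only
          nlinarith [hx.1]
      _ = ∫ x, max (-u x) 0 * g x := heq
      _ ≤ ∫ x, max (-u x) 0 := by
          refine integral_mono_ae hMg hM1 (hg.mono fun x hx => ?_)
          have : 0 ≤ max (-u x) 0 := le_max_right _ _
          simp only
          nlinarith [hx.2]
  obtain ⟨a, ha, ha0, har, ha1, ha2, ha3⟩ := exists_schwarz_symmetrization hd hPl
    (fun x => le_max_right _ _) hPR hrp (by
      rw [hPset, volume_ball_eq_ofReal _ hrp, hrpV, ENNReal.ofReal_toReal hpfin])
  obtain ⟨b, hb, hb0, hbr, hb1, hb2, hb3⟩ := exists_schwarz_symmetrization hd hMl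
    (fun x => le_max_right _ _) hMR hrm (by
      rw [hMset, volume_ball_eq_ofReal _ hrm, hrmV, ENNReal.ofReal_toReal hmfin])
  set t := α * (∫ x, a x) / ∫ x, b x with ht
  have hbpos : 0 < ∫ x, b x := by rw [hb1]; exact hMpos
  have ht0 : 0 ≤ t := div_nonneg (mul_nonneg hα0.le (integral_nonneg ha0)) hbpos.le
  have ht1 : t ≤ 1 := by
    rw [ht, div_le_one hbpos, ha1, hb1]
    exact hbal
  have hrμ : rm ^ 2 * μ < dirichletEV d (ball (0 : EuclideanSpace ℝ (Fin d)) 1) :=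
    sq_mul_lt_of_volume_lt hd hV hrm hμ0 (by rw [hrmV]; linarith) hsmall
  have hbN0 : 0 ≤ ∫ x, b x ^ 2 := integral_nonneg fun _ => by positivity
  have hbA : μ * ∫ x, b x ^ 2 ≤ ∫ x, ‖gradient b x‖ ^ 2 := by
    have h1 := dirichletEV_ball_mul_integral_sq_le ⟨K, hb⟩ hrm hbr
    have h2 : rm ^ 2 * (μ * ∫ x, b x ^ 2) ≤ rm ^ 2 * ∫ x, ‖gradient b x‖ ^ 2 := by
      refine le_trans ?_ h1
      rw [← mul_assoc]
      gcongr
    exact le_of_mul_le_mul_left h2 (by positivity)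
  refine exists_isBallPair_of_scale (b := fun x => t * b x) ⟨K, ha⟩
    (LipschitzWith.exists_const_mul ⟨K, hb⟩ t) ha0
    (fun x => mul_nonneg ht0 (hb0 x)) har (fun x hx => by simp [hbr x hx]) ?_ ?_ ?_
  · rw [integral_const_mul, ht, div_mul_cancel₀ _ hbpos.ne']
  · have : 0 ≤ ∫ x, (t * b x) ^ 2 := integral_nonneg fun _ => by positivity
    rw [ha2]
    linarith
  · simp_rw [norm_gradient_const_mul, mul_pow, sq_abs]
    rw [integral_const_mul, integral_const_mul]
    have h3 : t ^ 2 ≤ 1 := by nlinarith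
    have h4 := mul_le_mul_of_nonneg_left hbA (sub_nonneg.2 h3)
    have h5 : (∫ x, ‖gradient a x‖ ^ 2) + ∫ x, ‖gradient b x‖ ^ 2 ≤
        μ * ((∫ x, a x ^ 2) + ∫ x, b x ^ 2) := by
      rw [ha2, hb2, ← hN, ← hAN]
      linarith
    linarith

lemma exists_isBallPair_of_rayleigh_lt {d : ℕ} (hd : 0 < d) {α : ℝ} (hα0 : 0 < α)
    {Ω : Set (EuclideanSpace ℝ (Fin d))} (hΩb : Bornology.IsBounded Ω)
    {g u : EuclideanSpace ℝ (Fin d) → ℝ} (hgm : Measurable g)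
    (hg : ∀ᵐ x, α ≤ g x ∧ g x ≤ 1) (hu : IsDirTrial d Ω u) (horth : ∫ x, u x * g x = 0)
    (hsmall : (volume Ω).toReal ^ ((2 : ℝ) / d) * rayleigh d u <
      (2 : ℝ) ^ ((2 : ℝ) / d) *
        ((volume (ball (0 : EuclideanSpace ℝ (Fin d)) 1)).toReal ^ ((2 : ℝ) / d) *
          dirichletEV d (ball (0 : EuclideanSpace ℝ (Fin d)) 1))) :
    ∃ rp rm, 0 < rm ∧ rm ≤ rp ∧
      (volume (ball (0 : EuclideanSpace ℝ (Fin d)) 1)).toReal * rp ^ d +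
        (volume (ball (0 : EuclideanSpace ℝ (Fin d)) 1)).toReal * rm ^ d ≤ (volume Ω).toReal ∧
      ∃ a b, IsBallPair d α rp rm (rayleigh d u) a b := by
  rcases le_total (volume {x | u x < 0}) (volume {x | 0 < u x}) with hle | hle
  · exact exists_isBallPair_of_trial hd hα0 hΩb hgm hg hu horth hsmall hle
  · have hr : rayleigh d (fun x => -u x) = rayleigh d u := by
      simp [rayleigh, norm_gradient_neg]
    obtain ⟨⟨K, hK⟩, h0, hne⟩ := hu
    rw [← hr] at hsmall ⊢
    refine exists_isBallPair_of_trial hd hα0 hΩb hgm hg (u := fun x => -u x)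
      ⟨⟨K, hK.neg⟩, fun x hx => by simp [h0 x hx], fun h => hne ?_⟩ ?_ hsmall (by simpa using hle)
    · filter_upwards [h] with x hx
      simpa using hx
    · simp [neg_mul, integral_neg, horth]

/-- The cone function of height and radius `ρ` centred at `c`. -/
def coneBump {d : ℕ} (c : EuclideanSpace ℝ (Fin d)) (ρ : ℝ) (x : EuclideanSpace ℝ (Fin d)) : ℝ :=
  max (ρ - dist x c) 0

lemma lipschitzWith_coneBump {d : ℕ} (c : EuclideanSpace ℝ (Fin d)) (ρ : ℝ) :
    ∃ K, LipschitzWith K (coneBump c ρ) :=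
  ⟨_, ((LipschitzWith.const ρ).sub (LipschitzWith.dist_left c)).max_const 0⟩

lemma coneBump_eq_zero {d : ℕ} {c x : EuclideanSpace ℝ (Fin d)} {ρ : ℝ} (h : ρ ≤ dist x c) :
    coneBump c ρ x = 0 :=
  max_eq_right (sub_nonpos.2 h)

lemma integral_coneBump_mul_pos {d : ℕ} (c : EuclideanSpace ℝ (Fin d)) {ρ α : ℝ} (hρ : 0 < ρ)
    (hα : 0 < α) {g : EuclideanSpace ℝ (Fin d) → ℝ} (hgm : Measurable g)
    (hg : ∀ᵐ x, α ≤ g x ∧ g x ≤ 1) :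
    Integrable (fun x => coneBump c ρ x * g x) ∧ 0 < ∫ x, coneBump c ρ x * g x := by
  obtain ⟨K, hK⟩ := lipschitzWith_coneBump c ρ
  have hi : Integrable (coneBump c ρ) :=
    integrable_of_continuous_of_vanish (R := ρ + ‖c‖) hK.continuous fun x hx =>
      coneBump_eq_zero (by rw [dist_eq_norm]; linarith [norm_sub_norm_le x c])
  have hig := integrable_mul_weight hα hi hgm hg
  have h0 : ∀ x, 0 ≤ coneBump c ρ x := fun x => le_max_right _ _
  have hpos : 0 < ∫ x, coneBump c ρ x := by
    refine integral_pos_of_volume_pos h0 hi ((measure_ball_pos volume c hρ).trans_le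
      (measure_mono fun x hx => ?_))
    exact lt_max_of_lt_left (sub_pos.2 (mem_ball.1 hx))
  refine ⟨hig, (mul_pos hα hpos).trans_le ?_⟩
  rw [← integral_const_mul]
  refine integral_mono_ae (hi.const_mul α) hig (hg.mono fun x hx => ?_)
  have := h0 x
  simp only
  nlinarith [hx.1]

lemma exists_twisted_trial {d : ℕ} (hd : 0 < d) {α : ℝ} (hα : 0 < α)
    {Ω : Set (EuclideanSpace ℝ (Fin d))} (hΩo : IsOpen Ω) (hΩn : Ω.Nonempty)
    {g : EuclideanSpace ℝ (Fin d) → ℝ} (hgm : Measurable g)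
    (hg : ∀ᵐ x, α ≤ g x ∧ g x ≤ 1) : ∃ u, IsDirTrial d Ω u ∧ ∫ x, u x * g x = 0 := by
  have : Nontrivial (EuclideanSpace ℝ (Fin d)) := by
    have : Nonempty (Fin d) := ⟨⟨0, hd⟩⟩
    infer_instance
  obtain ⟨x₀, hx₀⟩ := hΩn
  obtain ⟨ε, hε, hball⟩ := Metric.isOpen_iff.1 hΩo x₀ hx₀
  obtain ⟨e, he⟩ := exists_norm_eq (EuclideanSpace ℝ (Fin d)) (c := ε / 2) (by positivity)
  set c := x₀ + e with hc
  have hdc : dist x₀ c = ε / 2 := by simp [hc, he]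
  obtain ⟨hi1, h1⟩ := integral_coneBump_mul_pos x₀ (ρ := ε / 4) (by positivity) hα hgm hg
  obtain ⟨hi2, h2⟩ := integral_coneBump_mul_pos c (ρ := ε / 4) (by positivity) hα hgm hg
  set s := ∫ x, coneBump c (ε / 4) x * g x
  set t := ∫ x, coneBump x₀ (ε / 4) x * g x
  have hlip : ∃ K, LipschitzWith K fun x =>
      s * coneBump x₀ (ε / 4) x - t * coneBump c (ε / 4) x := by
    obtain ⟨K, hK⟩ := LipschitzWith.exists_const_mul (lipschitzWith_coneBump x₀ (ε / 4)) s
    obtain ⟨K', hK'⟩ := LipschitzWith.exists_const_mul (lipschitzWith_coneBump c (ε / 4)) t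
    exact ⟨_, hK.sub hK'⟩
  refine ⟨_, ⟨hlip, fun x hx => ?_, fun h => ?_⟩, ?_⟩
  · have hx1 : ε ≤ dist x x₀ := not_lt.1 fun h => hx (hball h)
    have := dist_triangle_right x x₀ c
    rw [coneBump_eq_zero (by linarith), coneBump_eq_zero (by linarith)]
    simp
  · obtain ⟨K, hK⟩ := hlip
    have := congrFun ((Continuous.ae_eq_iff_eq volume hK.continuous continuous_const).1 h) x₀
    simp only [coneBump_eq_zero (show ε / 4 ≤ dist x₀ c by linarith), mul_zero, sub_zero,
      mul_eq_zero, h2.ne', false_or] at this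
    simp only [coneBump, dist_self, sub_zero] at this
    have := le_max_left (ε / 4) 0
    linarith
  · simp_rw [sub_mul, mul_assoc]
    rw [integral_sub (hi1.const_mul s) (hi2.const_mul t), integral_const_mul, integral_const_mul]
    exact sub_eq_zero.2 (mul_comm _ _)

lemma exists_seq_isBallPair {d : ℕ} (hd : 0 < d) {α : ℝ} (hα0 : 0 < α)
    {Ω : Set (EuclideanSpace ℝ (Fin d))} (hΩo : IsOpen Ω) (hΩb : Bornology.IsBounded Ω)
    (hΩn : Ω.Nonempty) {g : EuclideanSpace ℝ (Fin d) → ℝ} (hgm : Measurable g)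
    (hg : ∀ᵐ x, α ≤ g x ∧ g x ≤ 1)
    (hsmall : (volume Ω).toReal ^ ((2 : ℝ) / d) * twistedEV d Ω g <
      (2 : ℝ) ^ ((2 : ℝ) / d) *
        ((volume (ball (0 : EuclideanSpace ℝ (Fin d)) 1)).toReal ^ ((2 : ℝ) / d) *
          dirichletEV d (ball (0 : EuclideanSpace ℝ (Fin d)) 1))) :
    ∃ rp rm μ : ℕ → ℝ, Tendsto μ atTop (nhds (twistedEV d Ω g)) ∧ ∀ n, 0 < rm n ∧ rm n ≤ rp n ∧
      (volume (ball (0 : EuclideanSpace ℝ (Fin d)) 1)).toReal * rp n ^ d +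
        (volume (ball (0 : EuclideanSpace ℝ (Fin d)) 1)).toReal * rm n ^ d ≤ (volume Ω).toReal ∧
      ∃ a b, IsBallPair d α (rp n) (rm n) (μ n) a b := by
  obtain ⟨u, hu, horth⟩ := exists_twisted_trial hd hα0 hΩo hΩn hgm hg
  obtain ⟨ν, -, hν, hmem⟩ := exists_seq_tendsto_sInf
    (S := {r | ∃ u, IsDirTrial d Ω u ∧ (∫ x, u x * g x) = 0 ∧ rayleigh d u = r})
    ⟨_, u, hu, horth, rfl⟩ ⟨0, by rintro _ ⟨w, -, -, rfl⟩; exact rayleigh_nonneg w⟩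
  obtain ⟨n₀, hn₀⟩ := eventually_atTop.1
    ((hν.const_mul ((volume Ω).toReal ^ ((2 : ℝ) / d))).eventually_lt_const hsmall)
  have hpair : ∀ n, ∃ rp rm, 0 < rm ∧ rm ≤ rp ∧
      (volume (ball (0 : EuclideanSpace ℝ (Fin d)) 1)).toReal * rp ^ d +
        (volume (ball (0 : EuclideanSpace ℝ (Fin d)) 1)).toReal * rm ^ d ≤ (volume Ω).toReal ∧
      ∃ a b, IsBallPair d α rp rm (ν (n + n₀)) a b := by
    intro n
    obtain ⟨w, hw, hworth, hwr⟩ := hmem (n + n₀)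
    have := hn₀ (n + n₀) (by omega)
    rw [← hwr] at this ⊢
    exact exists_isBallPair_of_rayleigh_lt hd hα0 hΩb hgm hg hw hworth this
  choose rp rm h using hpair
  exact ⟨rp, rm, _, hν.comp (tendsto_add_atTop_nat n₀), h⟩

lemma exists_limit_radii {d : ℕ} (hd : 0 < d) {V W : ℝ} (hV : 0 < V) {rp rm : ℕ → ℝ}
    (h : ∀ n, 0 < rm n ∧ rm n ≤ rp n ∧ V * rp n ^ d + V * rm n ^ d ≤ W) :
    ∃ (p m : ℝ) (φ : ℕ → ℕ), StrictMono φ ∧ Tendsto (rp ∘ φ) atTop (nhds p) ∧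
      Tendsto (rm ∘ φ) atTop (nhds m) ∧ 0 ≤ m ∧ m ≤ p ∧ V * p ^ d + V * m ^ d ≤ W := by
  have hbd : ∀ n, (rp n, rm n) ∈ Icc (0 : ℝ) (max 1 (W / V)) ×ˢ Icc (0 : ℝ) (max 1 (W / V)) := by
    intro n
    obtain ⟨h1, h2, h3⟩ := h n
    have hp : rp n ≤ max 1 (W / V) := by
      rcases le_total (rp n) 1 with hp1 | hp1
      · exact hp1.trans (le_max_left _ _)
      · refine le_trans ?_ (le_max_right _ _)
        rw [le_div_iff₀ hV, mul_comm]
        have h4 := le_self_pow₀ hp1 hd.ne'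
        have h5 : 0 ≤ V * rm n ^ d := by positivity
        nlinarith
    exact ⟨⟨(h1.trans_le h2).le, hp⟩, h1.le, h2.trans hp⟩
  obtain ⟨⟨p, m⟩, -, φ, hφ, hlim⟩ :=
    (isCompact_Icc.prod isCompact_Icc).tendsto_subseq hbd
  have hp : Tendsto (rp ∘ φ) atTop (nhds p) := (continuous_fst.tendsto _).comp hlim
  have hm : Tendsto (rm ∘ φ) atTop (nhds m) := (continuous_snd.tendsto _).comp hlim
  refine ⟨p, m, φ, hφ, hp, hm, ge_of_tendsto' hm fun n => (h _).1.le,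
    le_of_tendsto_of_tendsto' hm hp fun n => (h _).2.1,
    le_of_tendsto' (((hp.pow d).const_mul V).add ((hm.pow d).const_mul V)) fun n => (h _).2.2⟩

lemma twistedEV_le_of_tendsto {d : ℕ} {α p m μ : ℝ} (hp : 0 < p) (hm : 0 < m)
    {rp rm ν : ℕ → ℝ} (hrp : Tendsto rp atTop (nhds p)) (hrm : Tendsto rm atTop (nhds m))
    (hν : Tendsto ν atTop (nhds μ)) (h : ∀ n, ∃ a b, IsBallPair d α (rp n) (rm n) (ν n) a b)
    {c : EuclideanSpace ℝ (Fin d)} (hc : p + m < ‖c‖) :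
    twistedEV d (ball 0 p ∪ ball c m) (chiBang d α (ball c m)) ≤ μ := by
  have hscale : ∀ t : ℝ, 1 < t →
      twistedEV d (ball 0 p ∪ ball c m) (chiBang d α (ball c m)) ≤ t ^ 2 * μ := by
    intro t ht
    refine ge_of_tendsto (hν.const_mul (t ^ 2)) ?_
    filter_upwards [hrp.eventually_lt_const (show p < t * p by nlinarith),
      hrm.eventually_lt_const (show m < t * m by nlinarith)] with n h1 h2
    obtain ⟨a, b, hab⟩ := h n
    obtain ⟨a', b', hab'⟩ := hab.exists_scale (by linarith : 0 < t) h1.le h2.le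
    exact hab'.twistedEV_le hc
  have hcont : Continuous fun t : ℝ => t ^ 2 * μ := by fun_prop
  have hlim : Tendsto (fun t : ℝ => t ^ 2 * μ) (nhdsWithin 1 (Ioi 1)) (nhds μ) := by
    simpa using (hcont.tendsto 1).mono_left nhdsWithin_le_nhds
  exact ge_of_tendsto hlim (eventually_mem_nhdsWithin.mono hscale)

theorem stmt12 (d : ℕ) (hd : 2 ≤ d) (α : ℝ) (hα0 : 0 < α) (hα1 : α ≤ 1)
    (Ω : Set (EuclideanSpace ℝ (Fin d)))
    (hΩo : IsOpen Ω) (hΩb : Bornology.IsBounded Ω) (hΩn : Ω.Nonempty)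
    (g : EuclideanSpace ℝ (Fin d) → ℝ) (hgm : Measurable g)
    (hg : ∀ᵐ x, α ≤ g x ∧ g x ≤ 1)
    (hsmall : (volume Ω).toReal ^ ((2 : ℝ) / d) * twistedEV d Ω g <
      (2 : ℝ) ^ ((2 : ℝ) / d) *
        ((volume (ball (0 : EuclideanSpace ℝ (Fin d)) 1)).toReal ^ ((2 : ℝ) / d) *
          dirichletEV d (ball (0 : EuclideanSpace ℝ (Fin d)) 1))) :
    ∃ (cp cm : EuclideanSpace ℝ (Fin d)) (rp rm : ℝ), 0 < rp ∧ 0 < rm ∧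
      Disjoint (ball cp rp) (ball cm rm) ∧
      volume (ball cm rm) ≤ volume (ball cp rp) ∧
      volume (ball cp rp ∪ ball cm rm) ≤ volume Ω ∧
      (volume (ball cp rp ∪ ball cm rm)).toReal ^ ((2 : ℝ) / d) *
          twistedEV d (ball cp rp ∪ ball cm rm) (chiBang d α (ball cm rm)) ≤
        (volume Ω).toReal ^ ((2 : ℝ) / d) * twistedEV d Ω g := by
  have hd0 : 0 < d := by omega
  have hdR : (0 : ℝ) < d := by positivity
  set V := (volume (ball (0 : EuclideanSpace ℝ (Fin d)) 1)).toReal with hVdef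
  set L := dirichletEV d (ball (0 : EuclideanSpace ℝ (Fin d)) 1) with hLdef
  set W := (volume Ω).toReal with hWdef
  have hV : 0 < V := volume_unitBall_toReal_pos
  have hW : 0 ≤ W := ENNReal.toReal_nonneg
  have hT := twistedEV_nonneg Ω g
  have hL : 0 < L := by
    have h1 : 0 ≤ W ^ ((2 : ℝ) / d) * twistedEV d Ω g := by positivity
    exact pos_of_mul_pos_right (pos_of_mul_pos_right (h1.trans_lt hsmall) (by positivity))
      (by positivity)
  obtain ⟨rp, rm, ν, hν, h⟩ := exists_seq_isBallPair hd0 hα0 hΩo hΩb hΩn hgm hg hsmall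
  obtain ⟨p, m, φ, hφ, hp, hm, hm0, hmp, hpm⟩ := exists_limit_radii hd0 hV
    fun n => ⟨(h n).1, (h n).2.1, (h n).2.2.1⟩
  have hνφ := hν.comp hφ.tendsto_atTop
  have hmpos : 0 < m := by
    refine hm0.lt_of_ne' fun hzero => ?_
    have hlim := ((continuous_pairMassBound (d := d) α V L
      (twistedEV d Ω g + 1)).tendsto m).comp hm
    rw [hzero, pairMassBound_zero hd0] at hlim
    refine absurd (ge_of_tendsto hlim ?_) one_pos.not_ge
    filter_upwards [hνφ.eventually_lt_const (lt_add_one _)] with n hn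
    obtain ⟨h1, -, -, a, b, hab⟩ := h (φ n)
    have hab' : IsBallPair d α (rp (φ n)) (rm (φ n)) (twistedEV d Ω g + 1) a b :=
      { hab with energy := hab.energy.trans hn.le }
    exact hab'.one_le_pairMassBound hd0 hα0 h1 (by positivity) hL
  have hppos : 0 < p := hmpos.trans_le hmp
  have : Nontrivial (EuclideanSpace ℝ (Fin d)) := by
    have : Nonempty (Fin d) := ⟨⟨0, hd0⟩⟩
    infer_instance
  obtain ⟨c, hc⟩ := exists_norm_eq (EuclideanSpace ℝ (Fin d)) (c := p + m + 1) (by positivity)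
  have hvol : volume (ball 0 p ∪ ball c m) ≤ volume Ω := by
    refine (measure_union_le _ _).trans ?_
    rw [volume_ball_eq_ofReal _ hppos, volume_ball_eq_ofReal _ hmpos,
      ← ENNReal.ofReal_add (by positivity) (by positivity)]
    exact ENNReal.ofReal_le_of_le_toReal hpm
  have hΩlt : volume Ω < ⊤ := hΩb.measure_lt_top
  refine ⟨0, c, p, m, hppos, hmpos, ball_disjoint_ball ?_, ?_, hvol, ?_⟩
  · rw [dist_zero_left, hc]
    linarith
  · rw [volume_ball_eq_ofReal _ hppos, volume_ball_eq_ofReal _ hmpos]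
    gcongr
  · have hle := twistedEV_le_of_tendsto (α := α) hppos hmpos hp hm hνφ (fun n => (h (φ n)).2.2.2)
      (c := c) (by linarith)
    have hmono := ENNReal.toReal_mono hΩlt.ne hvol
    gcongr
    exact twistedEV_nonneg _ _
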